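/- arXiv:1812.06627 — 13 statements merged into one kernel-verified Lean document; each statement's English description precedes it below -/
import Mathlib

section
/- Let R and n be positive integers such that C(R, n) < 2^(C(n,2) - 1), where C(a,b) denotes the binomial coefficient. Then r(n,n) > R; that is, there exists a coloring of the edges of the complete graph on R vertices with two colors having no monochromatic set of n vertices. -/
/-- Among the 2-colorings of a finite type `α`, a fraction `2 ^ (-#T)` is equal to `b` on `T`. -/
theorem card_filter_eq_on_mul_two_pow {α : Type*} [Fintype α] [DecidableEq α]
    (T : Finset α) (b : Bool) :
    (Finset.univ.filter fun f : α → Bool => ∀ x ∈ T, f x = b).card * 2 ^ T.card =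
      2 ^ Fintype.card α := by
  have key : (Finset.univ.filter fun f : α → Bool => ∀ x ∈ T, f x = b) =
      Fintype.piFinset fun x => if x ∈ T then {b} else Finset.univ := by
    ext f
    simp only [Finset.mem_filter, Finset.mem_univ, true_and, Fintype.mem_piFinset]
    refine forall_congr' fun x => ?_
    by_cases hx : x ∈ T <;> simp [hx]
  have hcard : ∀ x, (if x ∈ T then {b} else (Finset.univ : Finset Bool)).card =
      if x ∈ T then 1 else 2 := fun x => by
    split_ifs <;> simp
  rw [key, Fintype.card_piFinset, Finset.prod_congr rfl fun x _ => hcard x, Finset.prod_ite,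
    Finset.prod_const_one, one_mul, Finset.prod_const, ← pow_add, ← Finset.compl_filter,
    Finset.filter_univ_mem, Finset.card_compl_add_card]


/-- Probabilistic lower bound for Ramsey numbers: if `C(R,n) < 2^(C(n,2) - 1)`,
then `r(n,n) > R`, i.e. there is a 2-coloring of the edges of the complete graph
on `R` vertices with no monochromatic set of `n` vertices. -/
theorem ramsey_lower_bound (R n : ℕ) (hR : 0 < R) (hn : 0 < n)
    (h : R.choose n < 2 ^ (n.choose 2 - 1)) :
    ∃ C : Sym2 (Fin R) → Bool,
      ¬ ∃ S : Finset (Fin R), S.card = n ∧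
        ∃ b : Bool, ∀ i ∈ S, ∀ j ∈ S, i ≠ j → C s(i, j) = b := by
  classical
  have hn2 : 2 ≤ n := by
    by_contra! hlt
    obtain rfl : n = 1 := by omega
    simp at h
    omega
  have hm : 0 < n.choose 2 := Nat.choose_pos hn2
  by_contra! hall
  let E : Finset (Fin R) → Finset (Sym2 (Fin R)) := fun S => S.offDiag.image Sym2.mk.uncurry
  let P := Finset.powersetCard n (Finset.univ : Finset (Fin R)) ×ˢ (Finset.univ : Finset Bool)
  let A : Finset (Fin R) × Bool → Finset (Sym2 (Fin R) → Bool) := fun p =>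
    Finset.univ.filter fun f => ∀ e ∈ E p.1, f e = p.2
  have hcover : (Finset.univ : Finset (Sym2 (Fin R) → Bool)) ⊆ P.biUnion A := by
    intro f _
    obtain ⟨S, hS, b, hb⟩ := hall f
    simp only [Finset.mem_biUnion]
    refine ⟨(S, b), by simp [P, Finset.mem_powersetCard, hS], ?_⟩
    simp only [A, E, Finset.mem_filter, Finset.mem_univ, true_and, Finset.mem_image,
      Finset.mem_offDiag]
    rintro _ ⟨⟨i, j⟩, ⟨hi, hj, hij⟩, rfl⟩
    exact hb i hi j hj hij
  have hA : ∀ p ∈ P, (A p).card * 2 ^ n.choose 2 = 2 ^ Fintype.card (Sym2 (Fin R)) := by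
    intro p hp
    have hS : p.1.card = n := by
      simpa [P, Finset.mem_powersetCard] using hp
    have hE : (E p.1).card = n.choose 2 := by
      rw [← hS]
      exact Sym2.card_image_offDiag p.1
    rw [← hE]
    exact card_filter_eq_on_mul_two_pow (E p.1) p.2
  have hP : P.card = R.choose n * 2 := by
    simp [P, Finset.card_product, Finset.card_powersetCard]
  have hle : 2 ^ Fintype.card (Sym2 (Fin R)) ≤ ∑ p ∈ P, (A p).card := by
    simpa using (Finset.card_le_card hcover).trans Finset.card_biUnion_le
  have hmul : 2 ^ Fintype.card (Sym2 (Fin R)) * 2 ^ n.choose 2 ≤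
      2 ^ Fintype.card (Sym2 (Fin R)) * (R.choose n * 2) := by
    calc 2 ^ Fintype.card (Sym2 (Fin R)) * 2 ^ n.choose 2
        ≤ (∑ p ∈ P, (A p).card) * 2 ^ n.choose 2 := Nat.mul_le_mul_right _ hle
      _ = 2 ^ Fintype.card (Sym2 (Fin R)) * (R.choose n * 2) := by
        rw [Finset.sum_mul, Finset.sum_congr rfl hA, Finset.sum_const, hP, smul_eq_mul, mul_comm]
  have hpow : 2 ^ n.choose 2 ≤ R.choose n * 2 := Nat.le_of_mul_le_mul_left hmul (by positivity)
  have hsplit : 2 ^ (n.choose 2 - 1) * 2 = 2 ^ n.choose 2 := by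
    rw [← pow_succ, Nat.sub_add_cancel hm]
  omega
end

section
/- For every positive integer n, the Ramsey number satisfies r(n,n) > (1/8)·2^(n/2); that is, there exists a 2-coloring of the edges of the complete graph on ⌊(1/8)·2^(n/2)⌋ vertices with no monochromatic set of n vertices. -/
/-- The number of two-colorings of `α` that are constant with value `b` on `E`, times `2 ^ #E`,
is the number of all two-colorings. -/
theorem card_filter_const_on_mul_two_pow {α : Type*} [Fintype α] [DecidableEq α]
    (E : Finset α) (b : Bool) :
    (Finset.univ.filter fun C : α → Bool => ∀ e ∈ E, C e = b).card * 2 ^ E.card =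
      2 ^ Fintype.card α := by
  have h : (Finset.univ.filter fun C : α → Bool => ∀ e ∈ E, C e = b) =
      Fintype.piFinset fun e => if e ∈ E then {b} else Finset.univ := by
    ext C
    simp only [Finset.mem_filter, Finset.mem_univ, true_and, Fintype.mem_piFinset]
    refine forall_congr' fun e => ?_
    by_cases he : e ∈ E <;> simp [he]
  have hprod : ∏ e : α, (if e ∈ E then 2 else 1 : ℕ) = 2 ^ E.card := by
    simp
  rw [h, Fintype.card_piFinset, ← hprod, ← Finset.prod_mul_distrib,
    ← Finset.card_univ, ← Finset.prod_const]
  refine Finset.prod_congr rfl fun e _ => ?_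
  by_cases he : e ∈ E <;> simp [he]

/-- The Erdős counting bound: if `2 * (|V| choose n) < 2 ^ (n choose 2)`, then some two-coloring of
the complete graph on `V` has no monochromatic set of `n` vertices. -/
theorem exists_coloring_of_two_mul_choose_lt {V : Type*} [Fintype V] [DecidableEq V] (n : ℕ)
    (h : 2 * (Fintype.card V).choose n < 2 ^ n.choose 2) :
    ∃ C : Sym2 V → Bool, ¬ ∃ S : Finset V, S.card = n ∧
      ∃ b : Bool, ∀ i ∈ S, ∀ j ∈ S, i ≠ j → C s(i, j) = b := by
  by_contra! hC
  let E : Finset V → Finset (Sym2 V) := fun S => S.offDiag.image fun p => s(p.1, p.2)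
  let bad : Finset V × Bool → Finset (Sym2 V → Bool) := fun p =>
    Finset.univ.filter fun C => ∀ e ∈ E p.1, C e = p.2
  let I : Finset (Finset V × Bool) := Finset.univ.powersetCard n ×ˢ Finset.univ
  have hcover : (Finset.univ : Finset (Sym2 V → Bool)) ⊆ I.biUnion bad := by
    intro C _
    obtain ⟨S, hS, b, hb⟩ := hC C
    refine Finset.mem_biUnion.2 ⟨(S, b), by simp [I, hS], ?_⟩
    simp only [bad, E, Finset.mem_filter, Finset.mem_univ, true_and, Finset.mem_image,
      Finset.mem_offDiag]
    rintro _ ⟨⟨i, j⟩, ⟨hi, hj, hij⟩, rfl⟩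
    exact hb i hi j hj hij
  have hbad : ∀ p ∈ I, (bad p).card * 2 ^ n.choose 2 = 2 ^ Fintype.card (Sym2 V) := by
    rintro ⟨S, b⟩ hp
    have hS : S.card = n := by simpa [I] using hp
    have hE : (E S).card = n.choose 2 := by
      rw [← hS]
      exact Sym2.card_image_offDiag S
    rw [← hE]
    exact card_filter_const_on_mul_two_pow (E S) b
  have hI : I.card = 2 * (Fintype.card V).choose n := by
    simp [I, mul_comm]
  have hcard : 2 ^ Fintype.card (Sym2 V) ≤ ∑ p ∈ I, (bad p).card := by
    simpa using (Finset.card_le_card hcover).trans Finset.card_biUnion_le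
  have hmul := Nat.mul_le_mul_right (2 ^ n.choose 2) hcard
  rw [Finset.sum_mul, Finset.sum_congr rfl hbad, Finset.sum_const, smul_eq_mul, hI,
    mul_comm] at hmul
  exact absurd (Nat.le_of_mul_le_mul_right hmul (by positivity)) (not_le.2 h)

theorem two_mul_choose_lt_two_pow {N n : ℕ} (hn : 0 < n) (hN : 64 * N ^ 2 ≤ 2 ^ n) :
    2 * N.choose n < 2 ^ n.choose 2 := by
  have hT : (2 ^ n.choose 2) ^ 2 * 2 ^ n = (2 ^ n) ^ n := by
    rw [← pow_mul, ← pow_add, ← pow_mul, Nat.choose_two_right,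
      Nat.div_mul_cancel (Nat.even_mul_pred_self n).two_dvd]
    obtain ⟨m, rfl⟩ := Nat.exists_eq_succ_of_ne_zero hn.ne'
    simp only [Nat.succ_eq_add_one, Nat.add_sub_cancel]
    ring
  have hpow : 64 ^ n * (N ^ n) ^ 2 ≤ (2 ^ n.choose 2) ^ 2 * 2 ^ n := by
    rw [hT]
    calc 64 ^ n * (N ^ n) ^ 2 = (64 * N ^ 2) ^ n := by ring
      _ ≤ (2 ^ n) ^ n := Nat.pow_le_pow_left hN n
  have h64 : (64 : ℕ) ^ n = 32 ^ n * 2 ^ n := by norm_num [← mul_pow]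
  have hle : 32 ^ n * (N ^ n) ^ 2 ≤ (2 ^ n.choose 2) ^ 2 := by
    refine Nat.le_of_mul_le_mul_right (c := 2 ^ n) ?_ (by positivity)
    calc 32 ^ n * (N ^ n) ^ 2 * 2 ^ n = 64 ^ n * (N ^ n) ^ 2 := by rw [h64]; ring
      _ ≤ _ := hpow
  have h32 : 32 ≤ 32 ^ n := Nat.le_self_pow hn.ne' 32
  have hT0 : 0 < (2 ^ n.choose 2) ^ 2 := by positivity
  refine (Nat.mul_le_mul_left 2 (Nat.choose_le_pow N n)).trans_lt ?_
  refine lt_of_pow_lt_pow_left₀ 2 (Nat.zero_le _) ?_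
  nlinarith [Nat.mul_le_mul_right ((N ^ n) ^ 2) h32]

theorem sixty_four_mul_floor_sq_le (n : ℕ) :
    64 * ⌊(1 / 8 : ℝ) * (2 : ℝ) ^ ((n : ℝ) / 2)⌋₊ ^ 2 ≤ 2 ^ n := by
  have hfloor := Nat.floor_le (a := (1 / 8 : ℝ) * (2 : ℝ) ^ ((n : ℝ) / 2)) (by positivity)
  have hsq : ((2 : ℝ) ^ ((n : ℝ) / 2)) ^ 2 = 2 ^ n := by
    rw [← Real.rpow_natCast, ← Real.rpow_mul (by norm_num), ← Real.rpow_natCast]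
    congr 1
    push_cast
    ring
  have hreal := pow_le_pow_left₀ (Nat.cast_nonneg _) hfloor 2
  rw [mul_pow, hsq] at hreal
  have hcast : (64 : ℝ) * (⌊(1 / 8 : ℝ) * (2 : ℝ) ^ ((n : ℝ) / 2)⌋₊ : ℝ) ^ 2 ≤ 2 ^ n := by
    linarith
  exact_mod_cast hcast

/-- `r(n,n) > (1/8)·2^(n/2)`: there is a 2-coloring of the edges of the complete
graph on `⌊(1/8)·2^(n/2)⌋` vertices with no monochromatic set of `n` vertices. -/
theorem diagonal_ramsey_gt (n : ℕ) (hn : 0 < n) :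
    ∃ C : Sym2 (Fin ⌊(1 / 8 : ℝ) * (2 : ℝ) ^ ((n : ℝ) / 2)⌋₊) → Bool,
      ¬ ∃ S : Finset (Fin ⌊(1 / 8 : ℝ) * (2 : ℝ) ^ ((n : ℝ) / 2)⌋₊), S.card = n ∧
        ∃ b : Bool, ∀ i ∈ S, ∀ j ∈ S, i ≠ j → C s(i, j) = b := by
  refine exists_coloring_of_two_mul_choose_lt n ?_
  rw [Fintype.card_fin]
  exact two_mul_choose_lt_two_pow hn (sixty_four_mul_floor_sq_le n)
end

section
/- For every positive integer n there exist at least 1.05^n vertices of the n-dimensional cube graph Q_n that pairwise lie at distance greater than n/3 from each other; equivalently, there is a set of at least 1.05^n binary strings of length n whose pairwise Hamming distance exceeds n/3. -/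
/-- A finite type carries a finite set, pairwise related by a symmetric relation, such that every
point outside the set fails to be related to some point of it. -/
theorem exists_pairwise_finset_maximal {α : Type*} [Fintype α] (r : α → α → Prop)
    (hr : ∀ x y, r x y → r y x) :
    ∃ S : Finset α, (∀ x ∈ S, ∀ y ∈ S, x ≠ y → r x y) ∧ ∀ y ∉ S, ∃ x ∈ S, ¬ r x y := by
  classical
  obtain ⟨S, -, hS⟩ := (Set.toFinite
    {S : Finset α | ∀ x ∈ S, ∀ y ∈ S, x ≠ y → r x y}).exists_le_maximal
      (a := ∅) (by simp)
  refine ⟨S, hS.prop, fun y hy => ?_⟩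
  by_contra! h
  refine hy (hS.le_of_ge (y := insert y S) ?_ (Finset.subset_insert y S)
    (Finset.mem_insert_self y S))
  intro a ha b hb hab
  rcases Finset.mem_insert.mp ha with rfl | haS <;>
    rcases Finset.mem_insert.mp hb with rfl | hbS
  · exact absurd rfl hab
  · exact hr _ _ (h b hbS)
  · exact h a haS
  · exact hS.prop a haS b hbS hab

/-- The total weight of the cube, when agreeing coordinates weigh `a` and the others `b`. -/
theorem sum_prod_ite_bool (n : ℕ) (a b : ℝ) (x : Fin n → Bool) :
    ∑ y : Fin n → Bool, ∏ i, (if x i ≠ y i then b else a) = (a + b) ^ n := by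
  have h := Finset.prod_univ_sum (fun _ : Fin n => (Finset.univ : Finset Bool))
    (fun i t => if x i ≠ t then b else a)
  rw [Fintype.piFinset_univ] at h
  rw [← h]
  have h' : ∀ i, ∑ t : Bool, (if x i ≠ t then b else a) = a + b := by
    intro i
    cases x i <;> simp [add_comm]
  simp only [h', Finset.prod_const, Finset.card_univ, Fintype.card_fin]

/-- Points at distance at most `n / 3` have weight at least one, when agreeing coordinates weigh
`c ≥ 1` and the others `c⁻²`. -/
theorem one_le_prod_ite_of_hammingDist_le {n : ℕ} {c : ℝ} (hc : 1 ≤ c) {x y : Fin n → Bool}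
    (h : 3 * hammingDist x y ≤ n) :
    1 ≤ ∏ i, (if x i ≠ y i then (c ^ 2)⁻¹ else c) := by
  have hcard := Finset.card_filter_add_card_filter_not (s := (Finset.univ : Finset (Fin n)))
    (fun i => x i ≠ y i)
  rw [Finset.card_univ, Fintype.card_fin] at hcard
  rw [Finset.prod_ite, Finset.prod_const, Finset.prod_const, inv_pow, ← pow_mul,
    inv_mul_eq_div, one_le_div (by positivity)]
  apply pow_le_pow_right₀ hc
  unfold hammingDist at h
  omega

/-- There are at least `1.05^n` binary strings of length `n` whose pairwise
Hamming distance (that is, distance in the `n`-cube graph `Q_n`) exceeds `n/3`. -/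
theorem cube_far_apart_vertices (n : ℕ) (hn : 0 < n) :
    ∃ S : Finset (Fin n → Bool), (1.05 : ℝ) ^ n ≤ (S.card : ℝ) ∧
      ∀ x ∈ S, ∀ y ∈ S, x ≠ y → (n : ℝ) / 3 < (hammingDist x y : ℝ) := by
  obtain ⟨S, hS, hcover⟩ := exists_pairwise_finset_maximal
    (fun x y : Fin n → Bool => (n : ℝ) / 3 < (hammingDist x y : ℝ))
    (fun x y h => by rwa [hammingDist_comm])
  refine ⟨S, ?_, hS⟩
  let w : (Fin n → Bool) → (Fin n → Bool) → ℝ :=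
    fun x y => ∏ i, (if x i ≠ y i then ((5 / 4 : ℝ) ^ 2)⁻¹ else 5 / 4)
  have hw : ∀ x y, 0 ≤ w x y := fun x y =>
    Finset.prod_nonneg fun i _ => by split_ifs <;> positivity
  have hone : ∀ y, 1 ≤ ∑ x ∈ S, w x y := by
    intro y
    obtain ⟨x, hx, hxy⟩ : ∃ x ∈ S, 3 * hammingDist x y ≤ n := by
      by_cases hy : y ∈ S
      · exact ⟨y, hy, by simp⟩
      · obtain ⟨x, hx, hxy⟩ := hcover y hy
        refine ⟨x, hx, ?_⟩
        have : (3 * hammingDist x y : ℝ) ≤ n := by linarith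
        exact_mod_cast this
    exact (one_le_prod_ite_of_hammingDist_le (by norm_num) hxy).trans
      (Finset.single_le_sum (f := fun x => w x y) (fun x _ => hw x y) hx)
  have hvol : (2 : ℝ) ^ n ≤ S.card * (1.89 : ℝ) ^ n := calc
    (2 : ℝ) ^ n = ∑ _y : Fin n → Bool, (1 : ℝ) := by simp
    _ ≤ ∑ y, ∑ x ∈ S, w x y := Finset.sum_le_sum fun y _ => hone y
    _ = ∑ x ∈ S, ∑ y, w x y := Finset.sum_comm
    _ = S.card * (1.89 : ℝ) ^ n := by
      simp only [w, sum_prod_ite_bool, Finset.sum_const, nsmul_eq_mul]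
      norm_num
  refine le_of_mul_le_mul_right (le_trans ?_ hvol) (by positivity : (0 : ℝ) < 1.89 ^ n)
  rw [← mul_pow]
  exact pow_le_pow_left₀ (by norm_num) (by norm_num) n
end

section
/- For every positive integer n, the number of spanning trees of the fan graph F_n equals the Fibonacci number f_{2n}, where f_1 = f_2 = 1 and f_{k+1} = f_k + f_{k-1}. -/
/-- The fan graph `F n` on the `n+1` vertices `0, 1, …, n`: the hub `0` is
adjacent to every other vertex, and `i` is adjacent to `i+1` for `1 ≤ i ≤ n-1`. -/
def fanGraph (n : ℕ) : SimpleGraph (Fin (n + 1)) :=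
  SimpleGraph.fromRel (fun i j => i = 0 ∨ (i ≠ 0 ∧ (j : ℕ) = (i : ℕ) + 1))

/-- The number of spanning trees of a graph `G`: the number of subgraphs of `G`
on the full vertex set that are connected and acyclic. -/
noncomputable def numSpanningTrees {V : Type} (G : SimpleGraph V) : ℕ :=
  Nat.card {T : SimpleGraph V // T ≤ G ∧ T.IsTree}

/-- In a spanning tree of a fan rooted at the hub `0`, the label `c` of a vertex `i ≠ 0` records
its parent `j`: the hub if `c = 0`, the vertex `i + 1` if `c = 1`, and `i - 1` if `c = -1`. -/
def IsFanParent (c : SignType) (i j : ℕ) : Prop :=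
  i ≠ 0 ∧ (c = 0 ∧ j = 0 ∨ c = 1 ∧ j = i + 1 ∨ c = -1 ∧ j ≠ 0 ∧ i = j + 1)

/-- A labelling in which no two consecutive vertices are each other's parent and the last vertex
does not point beyond the end. -/
def IsFanCode {n : ℕ} (u : Fin (n + 1) → SignType) : Prop :=
  (∀ i : Fin n, ¬(u i.castSucc = 1 ∧ u i.succ = -1)) ∧ u (Fin.last n) ≠ 1

/-- The graph joining each vertex `i ≠ 0` to the parent recorded by its label. -/
def fanCodeGraph {n : ℕ} (u : Fin (n + 1) → SignType) : SimpleGraph (Fin (n + 1)) :=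
  SimpleGraph.fromRel (fun i j => IsFanParent (u i) i j)

namespace IsFanParent

variable {c d : SignType} {i j k : ℕ}

theorem right_unique (h : IsFanParent c i j) (h' : IsFanParent c i k) : j = k := by
  obtain ⟨-, ⟨rfl, h⟩ | ⟨rfl, h⟩ | ⟨rfl, h⟩⟩ := h <;> simp [IsFanParent] at h' <;> omega

theorem label_unique (h : IsFanParent c i j) (h' : IsFanParent d i j) : c = d := by
  obtain ⟨h0, ⟨rfl, h⟩ | ⟨rfl, h⟩ | ⟨rfl, h⟩⟩ := h <;>
    obtain ⟨-, ⟨rfl, h'⟩ | ⟨rfl, h'⟩ | ⟨rfl, h'⟩⟩ := h' <;> first | rfl | omega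

end IsFanParent

namespace IsFanCode

variable {n : ℕ} {u v : Fin (n + 1) → SignType}

theorem ne_one_of_eq_neg_one (hu : IsFanCode u) {i j : Fin (n + 1)} (hij : (j : ℕ) = i + 1)
    (hj : u j = -1) : u i ≠ 1 := by
  intro hi
  have hlt : (i : ℕ) < n := by have := j.isLt; omega
  refine hu.1 ⟨i, hlt⟩ ⟨hi, ?_⟩
  rwa [show (Fin.succ ⟨i, hlt⟩ : Fin (n + 1)) = j from Fin.ext (by simp [hij])]

theorem exists_isFanParent (hu : IsFanCode u) (h0 : u 0 = 1) {i : Fin (n + 1)} (hi : i ≠ 0) :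
    ∃ j : Fin (n + 1), IsFanParent (u i) i j := by
  have hi' : (i : ℕ) ≠ 0 := Fin.val_ne_zero_iff.2 hi
  obtain h | h | h : u i = 0 ∨ u i = 1 ∨ u i = -1 := by cases u i <;> simp
  · exact ⟨0, hi', .inl ⟨h, rfl⟩⟩
  · have hlast : i ≠ Fin.last n := by rintro rfl; exact hu.2 h
    have hlt : (i : ℕ) < n := Fin.val_lt_last hlast
    exact ⟨⟨i + 1, by omega⟩, hi', .inr (.inl ⟨h, rfl⟩)⟩
  · let j : Fin (n + 1) := ⟨i - 1, by omega⟩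
    have hij : (i : ℕ) = j + 1 := by simp only [j]; omega
    refine ⟨j, hi', .inr (.inr ⟨h, fun hj => ?_, hij⟩)⟩
    exact hu.ne_one_of_eq_neg_one hij h (by rwa [show j = 0 from Fin.ext hj])

end IsFanCode

variable {n : ℕ} {u v : Fin (n + 1) → SignType}

theorem fanCodeGraph_adj {i j : Fin (n + 1)} :
    (fanCodeGraph u).Adj i j ↔ IsFanParent (u i) i j ∨ IsFanParent (u j) j i := by
  rw [fanCodeGraph, SimpleGraph.fromRel_adj, and_iff_right_iff_imp]
  rintro h rfl
  simp only [IsFanParent] at h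
  omega

theorem fanCodeGraph_le_fanGraph : fanCodeGraph u ≤ fanGraph n := by
  intro i j h
  have hne := h.ne
  rw [fanCodeGraph_adj] at h
  simp only [fanGraph, SimpleGraph.fromRel_adj, IsFanParent, Fin.ext_iff, ne_eq, Fin.val_zero] at *
  omega

theorem fanCodeGraph_connected (hu : IsFanCode u) (h0 : u 0 = 1) :
    (fanCodeGraph u).Connected := by
  have left : ∀ (k : ℕ) (i : Fin (n + 1)), (i : ℕ) = k → u i ≠ 1 →
      (fanCodeGraph u).Reachable i 0 := by
    intro k
    induction k with
    | zero =>
      intro i hi _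
      rw [show i = 0 from Fin.ext hi]
    | succ k ih =>
      intro i hi h1
      obtain ⟨j, hj⟩ := hu.exists_isFanParent h0 (i := i) (by rintro rfl; simp at hi)
      have hadj : (fanCodeGraph u).Adj i j := fanCodeGraph_adj.2 (.inl hj)
      obtain ⟨-, ⟨-, h⟩ | ⟨h, -⟩ | ⟨h, -, hij⟩⟩ := hj
      · rw [show j = 0 from Fin.ext h] at hadj
        exact hadj.reachable
      · exact absurd h h1
      · exact hadj.reachable.trans (ih j (by omega) (hu.ne_one_of_eq_neg_one hij h))
  have all : ∀ i : Fin (n + 1), (fanCodeGraph u).Reachable i 0 := by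
    intro i
    by_cases h1 : u i = 1
    · by_cases hi : i = 0
      · rw [hi]
      obtain ⟨j, hj⟩ := hu.exists_isFanParent h0 hi
      refine (fanCodeGraph_adj.2 (.inl hj)).reachable.trans ?_
      rw [IsFanParent, h1] at hj
      obtain ⟨-, ⟨h, -⟩ | ⟨-, hij⟩ | ⟨h, -⟩⟩ := hj
      · simp at h
      · induction hm : n - j using Nat.strong_induction_on generalizing i j with
        | _ m ih =>
          by_cases hj1 : u j = 1
          · have hj0 : j ≠ 0 := by rintro rfl; simp at hij
            obtain ⟨k, hk⟩ := hu.exists_isFanParent h0 hj0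
            refine (fanCodeGraph_adj.2 (.inl hk)).reachable.trans ?_
            have hjk : (k : ℕ) = j + 1 := by
              rw [IsFanParent, hj1] at hk
              simpa using hk.2
            exact ih (n - k) (by omega) j hj1 hj0 k hjk rfl
          · exact left _ j rfl hj1
      · simp at h
    · exact left _ i rfl h1
  exact (SimpleGraph.connected_iff_exists_forall_reachable _).2 ⟨0, fun i => (all i).symm⟩

theorem card_edgeSet_fanCodeGraph_le : Nat.card (fanCodeGraph u).edgeSet ≤ n := by
  have child : ∀ e : (fanCodeGraph u).edgeSet, ∃ i : {i : Fin (n + 1) // i ≠ 0},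
      ∃ j : Fin (n + 1), e.1 = s(i.1, j) ∧ IsFanParent (u i) i.1 j := by
    rintro ⟨e, he⟩
    induction e with
    | _ i j =>
      rw [SimpleGraph.mem_edgeSet, fanCodeGraph_adj] at he
      obtain h | h := he
      · exact ⟨⟨i, fun hi => h.1 (by simp [hi])⟩, j, rfl, h⟩
      · exact ⟨⟨j, fun hj => h.1 (by simp [hj])⟩, i, Sym2.eq_swap, h⟩
  choose f g hg hp using child
  have hf : f.Injective := by
    intro e e' h
    have hpe := hp e
    rw [h] at hpe
    have hgg : g e = g e' := Fin.ext (hpe.right_unique (hp e'))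
    exact Subtype.ext (by rw [hg, hg, h, hgg])
  simpa using Nat.card_le_card_of_injective f hf

theorem fanCodeGraph_isTree (hu : IsFanCode u) (h0 : u 0 = 1) : (fanCodeGraph u).IsTree := by
  have hc := fanCodeGraph_connected hu h0
  refine SimpleGraph.isTree_iff_connected_and_card.2 ⟨hc, ?_⟩
  have h₁ := hc.card_vert_le_card_edgeSet_add_one
  have h₂ := card_edgeSet_fanCodeGraph_le (u := u)
  simp only [Nat.card_eq_fintype_card (α := Fin _), Fintype.card_fin] at h₁ ⊢
  omega

theorem eq_of_fanCodeGraph_eq_of_ne_one (hv : IsFanCode v) (hu0 : u 0 = 1) (hv0 : v 0 = 1)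
    (h : fanCodeGraph u = fanCodeGraph v) (k : ℕ) :
    ∀ i : Fin (n + 1), (i : ℕ) = k → v i ≠ 1 → u i = v i := by
  induction k with
  | zero =>
    intro i hi _
    rw [show i = 0 from Fin.ext hi, hu0, hv0]
  | succ k ih =>
    intro i hi h1
    obtain ⟨j, hj⟩ := hv.exists_isFanParent hv0 (i := i) (by rintro rfl; simp at hi)
    have hadj : (fanCodeGraph u).Adj i j := h ▸ fanCodeGraph_adj.2 (.inl hj)
    obtain hu | hu := fanCodeGraph_adj.1 hadj
    · exact hu.label_unique hj
    · obtain ⟨-, ⟨-, h'⟩ | ⟨h', -⟩ | ⟨h', -, hij⟩⟩ := hj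
      · exact absurd h' hu.1
      · exact absurd h' h1
      · have hv1 := hv.ne_one_of_eq_neg_one hij h'
        rw [ih j (by omega) hv1] at hu
        obtain ⟨-, ⟨-, h⟩ | ⟨h, -⟩ | ⟨-, -, h⟩⟩ := hu
        · omega
        · exact absurd h hv1
        · omega

theorem fanCodeGraph_injOn :
    Set.InjOn (fanCodeGraph (n := n)) {u | u 0 = 1 ∧ IsFanCode u} := by
  rintro u ⟨hu0, hu⟩ v ⟨hv0, hv⟩ h
  funext i
  by_cases hvi : v i = 1
  · by_cases hui : u i = 1
    · rw [hui, hvi]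
    · exact (eq_of_fanCodeGraph_eq_of_ne_one hu hv0 hu0 h.symm _ i rfl hui).symm
  · exact eq_of_fanCodeGraph_eq_of_ne_one hv hu0 hv0 h _ i rfl hvi

theorem SimpleGraph.Connected.exists_adj_dist_add_one_eq {V : Type*} {G : SimpleGraph V}
    (hG : G.Connected) {r i : V} (hi : i ≠ r) : ∃ j, G.Adj i j ∧ G.dist j r + 1 = G.dist i r := by
  obtain ⟨p, hp⟩ := hG.exists_walk_length_eq_dist i r
  cases p with
  | nil => exact absurd rfl hi
  | @cons _ j _ hadj q =>
    refine ⟨j, hadj, ?_⟩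
    have h₁ := SimpleGraph.dist_le q
    have h₂ := hG.dist_triangle (u := i) (v := j) (w := r)
    rw [SimpleGraph.dist_eq_one_iff_adj.2 hadj] at h₂
    rw [SimpleGraph.Walk.length_cons] at hp
    omega

theorem exists_isFanParent_of_fanGraph_adj {i j : Fin (n + 1)} (hi : i ≠ 0)
    (h : (fanGraph n).Adj i j) : ∃ c, IsFanParent c i j := by
  simp only [fanGraph, SimpleGraph.fromRel_adj, Fin.ext_iff, ne_eq, Fin.val_zero] at h hi
  by_cases hj : (j : ℕ) = 0
  · exact ⟨0, hi, .inl ⟨rfl, hj⟩⟩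
  by_cases hij : (j : ℕ) = i + 1
  · exact ⟨1, hi, .inr (.inl ⟨rfl, hij⟩)⟩
  · exact ⟨-1, hi, .inr (.inr ⟨rfl, hj, by omega⟩)⟩

theorem exists_fanCodeGraph_eq (hn : 0 < n) {T : SimpleGraph (Fin (n + 1))} (hT : T ≤ fanGraph n)
    (htree : T.IsTree) : ∃ u, u 0 = 1 ∧ IsFanCode u ∧ fanCodeGraph u = T := by
  have parent : ∀ i : Fin (n + 1), ∃ c : SignType, (i = 0 → c = 1) ∧
      (i ≠ 0 → ∃ j : Fin (n + 1),
        T.Adj i j ∧ T.dist j 0 + 1 = T.dist i 0 ∧ IsFanParent c i j) := by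
    intro i
    by_cases hi : i = 0
    · exact ⟨1, by simp [hi]⟩
    · obtain ⟨j, hadj, hd⟩ := htree.connected.exists_adj_dist_add_one_eq hi
      obtain ⟨c, hc⟩ := exists_isFanParent_of_fanGraph_adj hi (hT hadj)
      exact ⟨c, by simp [hi], fun _ => ⟨j, hadj, hd, hc⟩⟩
  choose u hu0 hu using parent
  have hparent : ∀ {i j : Fin (n + 1)}, IsFanParent (u i) i j →
      T.Adj i j ∧ T.dist j 0 + 1 = T.dist i 0 := by
    intro i j h
    obtain ⟨k, hadj, hd, hk⟩ := hu i (fun hi => h.1 (by simp [hi]))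
    obtain rfl : j = k := Fin.ext (h.right_unique hk)
    exact ⟨hadj, hd⟩
  have hcode : IsFanCode u := by
    refine ⟨fun i ⟨h₁, h₂⟩ => ?_, fun h => ?_⟩
    · by_cases hi : (i : ℕ) = 0
      · obtain ⟨j, -, -, hj⟩ := hu i.succ i.succ_ne_zero
        rw [h₂, IsFanParent, Fin.val_succ] at hj
        obtain ⟨-, ⟨h, -⟩ | ⟨h, -⟩ | ⟨-, hj0, hij⟩⟩ := hj
        · simp at h
        · simp at h
        · omega
      · have hr : IsFanParent (u i.castSucc) i.castSucc i.succ :=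
          ⟨hi, .inr (.inl ⟨h₁, rfl⟩)⟩
        have hl : IsFanParent (u i.succ) i.succ i.castSucc :=
          ⟨by simp, .inr (.inr ⟨h₂, hi, rfl⟩)⟩
        have := (hparent hr).2
        have := (hparent hl).2
        omega
    · obtain ⟨j, -, -, hj⟩ := hu (Fin.last n) (by simp [Fin.ext_iff]; omega)
      rw [h, IsFanParent] at hj
      simp at hj
      omega
  have hle : fanCodeGraph u ≤ T := by
    intro i j h
    obtain h | h := fanCodeGraph_adj.1 h
    · exact (hparent h).1
    · exact (hparent h).1.symm
  exact ⟨u, hu0 0 rfl, hcode, hle.antisymm <| (SimpleGraph.isTree_iff_minimal_connected.1 htree).2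
    (fanCodeGraph_connected hcode (hu0 0 rfl)) hle⟩

theorem isFanCode_cons {c : SignType} :
    IsFanCode (Fin.cons c u : Fin (n + 2) → SignType) ↔ ¬(c = 1 ∧ u 0 = -1) ∧ IsFanCode u := by
  simp only [IsFanCode, Fin.forall_fin_succ (n := n), ← Fin.succ_last, Fin.cons_succ,
    Fin.castSucc_zero, Fin.cons_zero, ← Fin.succ_castSucc, and_assoc]

theorem card_isFanCode (n : ℕ) (c : SignType) :
    Nat.card {u : Fin (n + 1) → SignType // u 0 = c ∧ IsFanCode u} =
      if c = 1 then Nat.fib (2 * n) else Nat.fib (2 * n + 1) := by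
  classical
  induction n generalizing c with
  | zero =>
    split_ifs with hc
    · simp only [IsFanCode, Nat.mul_zero, Nat.fib_zero, Nat.card_eq_zero]
      refine .inl ⟨fun u => u.2.2.2 ?_⟩
      exact u.2.1.trans hc
    · refine Nat.card_eq_one_iff_exists.2 ⟨⟨fun _ => c, rfl, fun i => i.elim0, hc⟩, fun u => ?_⟩
      ext i
      rw [Fin.fin_one_eq_zero i, u.2.1]
  | succ n ih =>
    let e : {u : Fin (n + 2) → SignType // u 0 = c ∧ IsFanCode u} ≃
        {u : Fin (n + 1) → SignType // ¬(c = 1 ∧ u 0 = -1) ∧ IsFanCode u} :=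
      { toFun := fun u => ⟨Fin.tail u.1, by
          have h := u.2.2
          rwa [← Fin.cons_self_tail u.1, isFanCode_cons, u.2.1] at h⟩
        invFun := fun u => ⟨Fin.cons c u.1, rfl, isFanCode_cons.2 u.2⟩
        left_inv := fun u => Subtype.ext (by
          simpa only [u.2.1] using Fin.cons_self_tail u.1)
        right_inv := fun u => rfl }
    rw [Nat.card_congr e, Nat.card_eq_fintype_card, Fintype.card_subtype,
      Finset.card_eq_sum_card_fiberwise (f := fun u => u 0) (t := Finset.univ) (by simp)]
    simp only [Nat.card_eq_fintype_card, Fintype.card_subtype] at ih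
    have fiber (d : SignType) : Finset.card {u ∈ ({u | ¬(c = 1 ∧ u 0 = -1) ∧ IsFanCode u} :
        Finset (Fin (n + 1) → SignType)) | u 0 = d} =
        if c = 1 ∧ d = -1 then 0
        else if d = 1 then Nat.fib (2 * n) else Nat.fib (2 * n + 1) := by
      rw [← ih, Finset.filter_filter]
      split_ifs with h
      · rw [Finset.card_eq_zero, Finset.filter_eq_empty_iff]
        rintro u - ⟨⟨h', -⟩, rfl⟩
        exact h' h
      · congr 1
        ext u
        simp only [Finset.mem_filter, Finset.mem_univ, true_and]
        constructor
        · rintro ⟨⟨-, h₁⟩, h₂⟩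
          exact ⟨h₂, h₁⟩
        · rintro ⟨rfl, h₁⟩
          exact ⟨⟨h, h₁⟩, rfl⟩
    simp only [fiber]
    have huniv : (Finset.univ : Finset SignType) = {0, -1, 1} := rfl
    have h₂ : Nat.fib (2 * (n + 1)) = Nat.fib (2 * n) + Nat.fib (2 * n + 1) := Nat.fib_add_two
    have h₃ : Nat.fib (2 * (n + 1) + 1) = Nat.fib (2 * n + 1) + Nat.fib (2 * (n + 1)) :=
      Nat.fib_add_two
    rw [huniv, h₃, h₂]
    by_cases hc : c = 1 <;> simp [hc] <;> omega

/-- The number of spanning trees of the fan `F n` is the Fibonacci number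
`f (2n)` (with `f 1 = f 2 = 1`). -/
theorem numSpanningTrees_fan (n : ℕ) (hn : 0 < n) :
    numSpanningTrees (fanGraph n) = Nat.fib (2 * n) := by
  refine Eq.trans (Nat.card_congr (Equiv.ofBijective (fun u : {u : Fin (n + 1) → SignType //
    u 0 = 1 ∧ IsFanCode u} => ⟨fanCodeGraph u.1, fanCodeGraph_le_fanGraph,
    fanCodeGraph_isTree u.2.2 u.2.1⟩) ⟨fun u v h => ?_, ?_⟩)).symm (card_isFanCode n 1)
  · exact Subtype.ext (fanCodeGraph_injOn u.2 v.2 (congrArg Subtype.val h))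
  · rintro ⟨T, hT, htree⟩
    obtain ⟨u, h0, hu, rfl⟩ := exists_fanCodeGraph_eq hn hT htree
    exact ⟨⟨u, h0, hu⟩, rfl⟩
end

section
/- (Matrix-tree theorem.) Let G be a simple graph on the vertex set {1, …, p} with p ≥ 2. Let M be the (p-1)×(p-1) matrix obtained from the Laplacian matrix of G (the matrix whose (i,i) entry is the degree of vertex i and whose (i,j) entry for i ≠ j is −1 if i and j are adjacent and 0 otherwise) by deleting its last row and last column. Then the number of spanning trees of G equals det M. -/
/-- The Laplacian (Kirchhoff) matrix of a simple graph on `{0, …, p-1}`: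
diagonal entries are the vertex degrees, and the `(i,j)` entry for `i ≠ j` is
`-1` if `i` and `j` are adjacent and `0` otherwise. -/
def laplacianMatrix {p : ℕ} (G : SimpleGraph (Fin p)) [DecidableRel G.Adj] :
    Matrix (Fin p) (Fin p) ℤ :=
  Matrix.of fun i j => if i = j then (G.degree i : ℤ) else if G.Adj i j then -1 else 0

/-- The Kirchhoff minor: the Laplacian with the last row and column deleted. -/
def kirchhoffMinor {p : ℕ} (G : SimpleGraph (Fin p)) [DecidableRel G.Adj] :
    Matrix (Fin (p - 1)) (Fin (p - 1)) ℤ :=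
  Matrix.of fun i j =>
    laplacianMatrix G ⟨i, lt_of_lt_of_le i.isLt (Nat.sub_le p 1)⟩
      ⟨j, lt_of_lt_of_le j.isLt (Nat.sub_le p 1)⟩

namespace MatrixTree

open Matrix

variable {V : Type} {r : V}

/-- `ParentRel f a b` says that `a` is the parent of the non-root vertex `b` under the parent
function `f`. -/
def ParentRel (f : {v : V // v ≠ r} → V) (a b : V) : Prop :=
  ∃ h : b ≠ r, f ⟨b, h⟩ = a

/-- The graph joining every non-root vertex to its parent. -/
def parentGraph (f : {v : V // v ≠ r} → V) : SimpleGraph V :=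
  SimpleGraph.fromRel (ParentRel f)

/-- The matrix whose row at `i` is `e i - e (f i)`, where the basis vector of the root is
read as `0`. -/
def parentMatrix [DecidableEq V] (f : {v : V // v ≠ r} → V) :
    Matrix {v : V // v ≠ r} {v : V // v ≠ r} ℤ :=
  Matrix.of fun i j => (if (i : V) = j then 1 else 0) - (if f i = j then 1 else 0)

lemma parentRel_apply (f : {v : V // v ≠ r} → V) (i : {v : V // v ≠ r}) :
    ParentRel f (f i) i :=
  ⟨i.2, rfl⟩

lemma parentGraph_adj_apply {f : {v : V // v ≠ r} → V} (hf : WellFounded (ParentRel f))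
    (i : {v : V // v ≠ r}) : (parentGraph f).Adj i (f i) := by
  refine (SimpleGraph.fromRel_adj _ _ _).2 ⟨fun h => ?_, Or.inr (parentRel_apply f i)⟩
  have hi := parentRel_apply f i
  rw [← h] at hi
  exact hf.irrefl.irrefl _ hi

lemma parentGraph_le {f : {v : V // v ≠ r} → V} {G : SimpleGraph V}
    (h : ∀ i : {v : V // v ≠ r}, G.Adj i (f i)) : parentGraph f ≤ G := by
  intro a b hab
  obtain ⟨-, ⟨hb, rfl⟩ | ⟨ha, rfl⟩⟩ := (SimpleGraph.fromRel_adj _ _ _).1 hab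
  · exact (h ⟨b, hb⟩).symm
  · exact h ⟨a, ha⟩

lemma parentGraph_connected {f : {v : V // v ≠ r} → V} (hf : WellFounded (ParentRel f)) :
    (parentGraph f).Connected := by
  have hroot : ∀ v, (parentGraph f).Reachable v r := by
    intro v
    induction v using hf.induction with
    | _ v ih =>
      by_cases hv : v = r
      · rw [hv]
      · exact (parentGraph_adj_apply hf ⟨v, hv⟩).reachable.trans
          (ih _ (parentRel_apply f ⟨v, hv⟩))
  exact SimpleGraph.connected_iff_exists_forall_reachable _ |>.2 ⟨r, fun v => (hroot v).symm⟩

lemma parentGraph_isTree [Finite V] {f : {v : V // v ≠ r} → V}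
    (hf : WellFounded (ParentRel f)) : (parentGraph f).IsTree := by
  classical
  have := Fintype.ofFinite V
  have hconn := parentGraph_connected hf
  refine SimpleGraph.isTree_iff_connected_and_card.2
    ⟨hconn, le_antisymm ?_ hconn.card_vert_le_card_edgeSet_add_one⟩
  have hsub : (parentGraph f).edgeSet ⊆ Set.range fun i : {v : V // v ≠ r} => s((i : V), f i) := by
    intro e
    induction e using Sym2.ind with
    | _ a b =>
      intro hab
      rw [SimpleGraph.mem_edgeSet] at hab
      obtain ⟨-, ⟨hb, rfl⟩ | ⟨ha, rfl⟩⟩ := (SimpleGraph.fromRel_adj _ _ _).1 hab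
      · exact ⟨⟨b, hb⟩, Sym2.eq_swap⟩
      · exact ⟨⟨a, ha⟩, rfl⟩
  have hcard : Nat.card (parentGraph f).edgeSet ≤ Nat.card {v : V // v ≠ r} :=
    (Nat.card_mono (Set.toFinite _) hsub).trans (Finite.card_range_le _)
  have hV : Nat.card {v : V // v ≠ r} + 1 = Nat.card V := by
    have := Fintype.card_pos_iff.2 ⟨r⟩
    simp only [Nat.card_eq_fintype_card, ne_eq, Fintype.card_subtype_compl,
      Fintype.card_unique]
    omega
  omega

lemma eq_of_parentGraph_eq {f g : {v : V // v ≠ r} → V} (hg : WellFounded (ParentRel g))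
    (h : parentGraph f = parentGraph g) : f = g := by
  suffices ∀ v (hv : v ≠ r), f ⟨v, hv⟩ = g ⟨v, hv⟩ from funext fun i => this i i.2
  intro v
  induction v using hg.induction with
  | _ v ih =>
    intro hv
    have hadj := parentGraph_adj_apply hg ⟨v, hv⟩
    rw [← h] at hadj
    obtain ⟨-, ⟨hw, hfw⟩ | ⟨_, hfv⟩⟩ := (SimpleGraph.fromRel_adj _ _ _).1 hadj
    · have hgv := parentRel_apply g ⟨v, hv⟩
      exact absurd ⟨hw, (ih _ hgv hw).symm.trans hfw⟩ (hg.asymmetric _ _ hgv)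
    · exact hfv

lemma exists_parent_of_connected {T : SimpleGraph V} (hT : T.Connected) :
    ∃ f : {v : V // v ≠ r} → V, WellFounded (ParentRel f) ∧
      ∀ i : {v : V // v ≠ r}, T.Adj i (f i) := by
  have hnext : ∀ i : {v : V // v ≠ r}, ∃ w, T.Adj i w ∧ T.dist w r < T.dist i r := by
    rintro ⟨v, hv⟩
    obtain ⟨p, hp⟩ := hT.exists_walk_length_eq_dist v r
    cases p with
    | nil => exact absurd rfl hv
    | cons hadj q =>
      refine ⟨_, hadj, ?_⟩
      have := SimpleGraph.dist_le q
      rw [SimpleGraph.Walk.length_cons] at hp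
      dsimp only
      omega
  choose f hadj hlt using hnext
  refine ⟨f, Subrelation.wf ?_ (measure fun v => T.dist v r).wf, hadj⟩
  rintro _ b ⟨hb, rfl⟩
  exact hlt ⟨b, hb⟩

/-- Spanning trees of `G` correspond to well-founded parent functions along edges of `G`. -/
lemma card_spanningTrees_eq [Finite V] (G : SimpleGraph V) (r : V) :
    numSpanningTrees G = Nat.card {f : {v : V // v ≠ r} → V //
      (∀ i : {v : V // v ≠ r}, G.Adj i (f i)) ∧ WellFounded (ParentRel f)} := by
  symm
  refine Nat.card_congr (Equiv.ofBijective
    (fun f => ⟨parentGraph f.1, parentGraph_le f.2.1, parentGraph_isTree f.2.2⟩) ⟨?_, ?_⟩)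
  · intro f g h
    exact Subtype.ext (eq_of_parentGraph_eq g.2.2 (congrArg Subtype.val h))
  · rintro ⟨T, hTG, hT⟩
    obtain ⟨f, hf, hadj⟩ := exists_parent_of_connected (r := r) hT.connected
    refine ⟨⟨f, fun i => hTG (hadj i), hf⟩, Subtype.ext ?_⟩
    have hle := parentGraph_le hadj
    exact hle.antisymm ((SimpleGraph.isTree_iff_minimal_connected.1 hT).2
      (parentGraph_connected hf) hle)

variable [Fintype V] [DecidableEq V]

lemma det_parentMatrix_of_wellFounded {f : {v : V // v ≠ r} → V}
    (hf : WellFounded (ParentRel f)) : (parentMatrix f).det = 1 := by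
  have : IsWellFounded V (ParentRel f) := ⟨hf⟩
  have hlt (i : {v : V // v ≠ r}) :
      IsWellFounded.rank (ParentRel f) (f i) < IsWellFounded.rank (ParentRel f) i :=
    IsWellFounded.rank_lt_of_rel (parentRel_apply f i)
  have htri : (parentMatrix f)ᵀ.BlockTriangular
      fun i => IsWellFounded.rank (ParentRel f) (i : V) := by
    intro i j hij
    have h₁ : (j : V) ≠ i := by
      intro h
      simp [h] at hij
    have h₂ : f j ≠ i := by
      intro h
      have := hlt j
      rw [h] at this
      exact this.asymm hij
    simp [parentMatrix, h₁, h₂]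
  rw [← det_transpose, htri.det]
  refine Finset.prod_eq_one fun a _ => ?_
  suffices (parentMatrix f)ᵀ.toSquareBlock
      (fun i => IsWellFounded.rank (ParentRel f) (i : V)) a = 1 by rw [this, det_one]
  ext ⟨i, hi⟩ ⟨j, hj⟩
  have h₂ : f j ≠ i := by
    intro h
    have := hlt j
    rw [h] at this
    exact this.ne (hi.trans hj.symm)
  simp [toSquareBlock, toSquareBlockProp, parentMatrix, h₂.symm, one_apply, Subtype.ext_iff, eq_comm]

lemma det_parentMatrix_of_not_wellFounded {f : {v : V // v ≠ r} → V}
    (hf : ¬ WellFounded (ParentRel f)) : (parentMatrix f).det = 0 := by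
  classical
  have hroot : Acc (ParentRel f) r := by
    refine ⟨_, ?_⟩
    rintro _ ⟨h, -⟩
    exact absurd rfl h
  have hstep (i : {v : V // v ≠ r}) : Acc (ParentRel f) (f i) ↔ Acc (ParentRel f) i := by
    refine ⟨fun h => ⟨_, ?_⟩, fun h => h.inv (parentRel_apply f i)⟩
    rintro _ ⟨_, rfl⟩
    exact h
  refine exists_mulVec_eq_zero_iff.1
    ⟨fun i => if Acc (ParentRel f) (i : V) then 0 else 1, ?_, ?_⟩
  · intro h
    refine hf ⟨fun v => by_contra fun hv => ?_⟩
    have hvr : v ≠ r := by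
      rintro rfl
      exact hv hroot
    simpa [hv] using congrFun h ⟨v, hvr⟩
  · ext i
    have hsum (a : V) : ∑ j : {v : V // v ≠ r},
        (if a = j then 1 else 0) * (if Acc (ParentRel f) (j : V) then (0 : ℤ) else 1) =
          if Acc (ParentRel f) a then 0 else 1 := by
      by_cases ha : a = r
      · subst ha
        rw [if_pos hroot]
        exact Finset.sum_eq_zero fun j _ => by simp [j.2.symm]
      · rw [Finset.sum_eq_single ⟨a, ha⟩]
        · simp
        · intro j _ hj
          rw [if_neg fun h => hj (Subtype.ext h.symm), zero_mul]
        · simp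
    simp only [mulVec, dotProduct, parentMatrix, of_apply, sub_mul, Finset.sum_sub_distrib, hsum,
      hstep, sub_self, Pi.zero_apply]

/-- The determinant of a reduced Laplacian, expanded by rows over all choices of neighbours. -/
lemma det_reducedLaplacian (G : SimpleGraph V) [DecidableRel G.Adj] (r : V) :
    ((Matrix.of fun i j : {v : V // v ≠ r} =>
      if (i : V) = j then (G.degree i : ℤ) else if G.Adj i j then -1 else 0).det) =
      Nat.card {f : {v : V // v ≠ r} → V //
        (∀ i : {v : V // v ≠ r}, G.Adj i (f i)) ∧ WellFounded (ParentRel f)} := by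
  classical
  have hrows : (Matrix.of fun i j : {v : V // v ≠ r} =>
      if (i : V) = j then (G.degree i : ℤ) else if G.Adj i j then -1 else 0) =
      fun i : {v : V // v ≠ r} => ∑ w ∈ G.neighborFinset i, fun j : {v : V // v ≠ r} =>
        (if (i : V) = j then (1 : ℤ) else 0) - (if w = j then 1 else 0) := by
    ext i j
    rw [Finset.sum_apply, Finset.sum_sub_distrib]
    by_cases hij : (i : V) = j
    · simp [hij]
    · simp [hij]
      split_ifs <;> simp
  have hdet (f : {v : V // v ≠ r} → V) :
      (parentMatrix f).det = if WellFounded (ParentRel f) then 1 else 0 := by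
    split_ifs with h
    · exact det_parentMatrix_of_wellFounded h
    · exact det_parentMatrix_of_not_wellFounded h
  rw [hrows]
  refine (detRowAlternating.toMultilinearMap.map_sum_finset
    (fun (i : {v : V // v ≠ r}) (w : V) (j : {v : V // v ≠ r}) =>
      (if (i : V) = j then (1 : ℤ) else 0) - (if w = j then 1 else 0))
    (fun i => G.neighborFinset i)).trans ?_
  refine (Finset.sum_congr rfl fun f _ => hdet f).trans ?_
  rw [Finset.sum_boole, Nat.card_eq_fintype_card, Fintype.card_subtype]
  congr 2
  ext f
  simp [Fintype.mem_piFinset]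

end MatrixTree

/-- Matrix-tree theorem: the number of spanning trees of a simple graph `G` on
`p ≥ 2` vertices equals the determinant of its Kirchhoff minor. -/
theorem matrix_tree_theorem (p : ℕ) (hp : 2 ≤ p) (G : SimpleGraph (Fin p))
    [DecidableRel G.Adj] :
    (numSpanningTrees G : ℤ) = (kirchhoffMinor G).det := by
  obtain ⟨n, rfl⟩ : ∃ n, p = n + 1 := ⟨p - 1, by omega⟩
  rw [MatrixTree.card_spanningTrees_eq G (Fin.last n), ← MatrixTree.det_reducedLaplacian,
    ← Matrix.det_submatrix_equiv_self (finSuccAboveEquiv (Fin.last n))]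
  congr 1
  ext i j
  simp [kirchhoffMinor, laplacianMatrix, finSuccAboveEquiv_apply, Fin.ext_iff]
  rfl
end

section
/- (Cayley formula.) For every integer p ≥ 2, the number of spanning trees of the complete graph K_p on p labeled vertices equals p^(p-2). -/
open Function in
/-- If every point eventually reaches a set of fixed points `R` under `f`, then points outside `R`
are not periodic. -/
theorem iterate_succ_ne_self_of_reaches {V : Type*} {f : V → V} {R : Finset V}
    (hfix : ∀ r ∈ R, f r = r) (hreach : ∀ v, ∃ n, f^[n] v ∈ R) {v : V} (hv : v ∉ R) (j : ℕ) :
    f^[j + 1] v ≠ v := by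
  intro hper
  obtain ⟨n, hn⟩ := hreach v
  have hmul : f^[(j + 1) * n] v = v := by
    rw [iterate_mul]
    exact iterate_fixed hper n
  have hsplit : (j + 1) * n = j * n + n := by ring
  rw [hsplit, iterate_add_apply, iterate_fixed (hfix _ hn)] at hmul
  exact hv (hmul ▸ hn)

open Function in
theorem iterate_conj {V : Type*} (σ : Equiv.Perm V) (f : V → V) (n : ℕ) (u : V) :
    (σ ∘ f ∘ σ.symm)^[n] u = σ (f^[n] (σ.symm u)) := by
  induction n generalizing u with
  | zero => simp
  | succ n ih => simp [iterate_succ_apply, ih]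

open Function in
theorem iterate_update_of_forall_ne {V : Type*} [DecidableEq V] {f : V → V} {v u w : V}
    (h : ∀ i, f^[i] w ≠ v) (n : ℕ) :
    (update f v u)^[n] w = f^[n] w := by
  induction n with
  | zero => rfl
  | succ n ih => rw [iterate_succ_apply', ih, update_of_ne (h n), iterate_succ_apply']

open Classical in
/-- The parent functions of forests on `V` rooted at `R`: the points of `R` are fixed, and every
vertex eventually reaches `R`. -/
noncomputable def rootedForests {V : Type*} [Fintype V] (R : Finset V) : Finset (V → V) :=
  {f | (∀ r ∈ R, f r = r) ∧ ∀ v, ∃ n, f^[n] v ∈ R}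

open Classical in
/-- Forests rooted at `R` with a marked vertex whose root lies in `S`. -/
noncomputable def markedForests {V : Type*} [Fintype V] (R S : Finset V) : Finset ((V → V) × V) :=
  {x | x.1 ∈ rootedForests R ∧ ∃ n, x.1^[n] x.2 ∈ S}

section Forests

open Finset Function

variable {V : Type*} [Fintype V]

theorem mem_rootedForests {R : Finset V} {f : V → V} :
    f ∈ rootedForests R ↔ (∀ r ∈ R, f r = r) ∧ ∀ v, ∃ n, f^[n] v ∈ R := by
  simp [rootedForests]

theorem mem_markedForests {R S : Finset V} {x : (V → V) × V} :
    x ∈ markedForests R S ↔ x.1 ∈ rootedForests R ∧ ∃ n, x.1^[n] x.2 ∈ S := by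
  simp [markedForests]

theorem conj_mem_rootedForests {R : Finset V} {σ : Equiv.Perm V} (hσ : ∀ v, σ v ∈ R ↔ v ∈ R)
    {f : V → V} (hf : f ∈ rootedForests R) : σ ∘ f ∘ σ.symm ∈ rootedForests R := by
  rw [mem_rootedForests] at hf ⊢
  refine ⟨fun r hr => ?_, fun v => ?_⟩
  · have : σ.symm r ∈ R := by rw [← hσ]; simpa
    simp [hf.1 _ this]
  · obtain ⟨n, hn⟩ := hf.2 (σ.symm v)
    exact ⟨n, by rw [iterate_conj, hσ]; exact hn⟩

theorem card_markedForests_singleton_le {R : Finset V} {r s : V} (hr : r ∈ R) (hs : s ∈ R) :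
    #(markedForests R {r}) ≤ #(markedForests R {s}) := by
  classical
  set σ := Equiv.swap r s with hσ
  have hR : ∀ v, σ v ∈ R ↔ v ∈ R := by
    intro v
    rw [hσ, Equiv.swap_apply_def]
    split_ifs <;> simp_all
  refine card_le_card_of_injOn (fun x => (σ ∘ x.1 ∘ σ.symm, σ x.2)) ?_ ?_
  · rintro ⟨f, u⟩ hx
    simp only [mem_coe, mem_markedForests, mem_singleton] at hx ⊢
    obtain ⟨hf, n, hn⟩ := hx
    refine ⟨conj_mem_rootedForests hR hf, n, ?_⟩
    rw [iterate_conj, Equiv.symm_apply_apply, hn, hσ, Equiv.swap_apply_left]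
  · rintro ⟨f, u⟩ - ⟨g, w⟩ - h
    simp only [Prod.mk.injEq, EmbeddingLike.apply_eq_iff_eq] at h
    refine Prod.ext (funext fun v => ?_) h.2
    simpa using congrFun h.1 (σ v)

theorem card_markedForests {R S : Finset V} (hS : S ⊆ R) {r : V} (hr : r ∈ R) :
    #(markedForests R S) = #S * #(markedForests R {r}) := by
  classical
  have hunion : markedForests R S = S.biUnion fun s => markedForests R {s} := by
    ext x
    simp only [mem_markedForests, mem_biUnion, mem_singleton]
    grind
  rw [hunion, card_biUnion]
  · exact sum_const_nat fun s hs => le_antisymm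
      (card_markedForests_singleton_le (hS hs) hr) (card_markedForests_singleton_le hr (hS hs))
  · intro s hs t ht hst
    refine disjoint_left.2 fun x hxs hxt => hst ?_
    simp only [mem_markedForests, mem_singleton, mem_rootedForests] at hxs hxt
    obtain ⟨⟨hfix, -⟩, n, hn⟩ := hxs
    obtain ⟨-, m, hm⟩ := hxt
    have h₁ : x.1^[m + n] x.2 = s := by
      rw [iterate_add_apply, hn, iterate_fixed (hfix s (hS hs))]
    have h₂ : x.1^[m + n] x.2 = t := by
      rw [add_comm, iterate_add_apply, hm, iterate_fixed (hfix t (hS ht))]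
    exact h₁.symm.trans h₂

/-- By symmetry between the roots, a proportion `#S / #R` of the marked vertices has its root
in `S`. -/
theorem card_mul_card_markedForests {R S : Finset V} (hS : S ⊆ R) :
    #R * #(markedForests R S) = #S * (Fintype.card V * #(rootedForests R)) := by
  obtain rfl | ⟨r, hr⟩ := R.eq_empty_or_nonempty
  · simp [subset_empty.1 hS]
  have hall : markedForests R R = rootedForests R ×ˢ univ := by
    ext x
    simp only [mem_markedForests, mem_product, mem_univ, and_true, and_iff_left_iff_imp]
    exact fun h => (mem_rootedForests.1 h).2 x.2
  have hcard := card_markedForests (Subset.refl R) hr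
  rw [hall, card_product, card_univ] at hcard
  rw [card_markedForests hS hr, mul_comm (Fintype.card V), hcard]
  ring

variable [DecidableEq V]

/-- Cutting a forest rooted at `R` above a vertex `v ∉ R`. -/
theorem cut_mem_markedForests {R : Finset V} {v : V} (hv : v ∉ R) {f : V → V}
    (hf : f ∈ rootedForests R) : (update f v v, f v) ∈ markedForests (insert v R) R := by
  rw [mem_rootedForests] at hf
  simp only [mem_markedForests, mem_rootedForests]
  refine ⟨⟨fun r hr => ?_, fun w => ?_⟩, ?_⟩
  · by_cases h : r = v
    · simp [h]
    · rw [update_of_ne h, hf.1 r (mem_of_mem_insert_of_ne hr h)]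
  · obtain ⟨n, hn⟩ := hf.2 w
    induction n generalizing w with
    | zero => exact ⟨0, mem_insert_of_mem hn⟩
    | succ n ih =>
      by_cases h : w = v
      · exact ⟨0, by simp [h]⟩
      · obtain ⟨m, hm⟩ := ih (f w) hn
        exact ⟨m + 1, by rwa [iterate_succ_apply, update_of_ne h]⟩
  · obtain ⟨n, hn⟩ := hf.2 (f v)
    refine ⟨n, ?_⟩
    rwa [iterate_update_of_forall_ne]
    exact fun i => iterate_succ_ne_self_of_reaches hf.1 hf.2 hv i

/-- Grafting the tree with root `v` onto a vertex of a tree with another root. -/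
theorem graft_mem_rootedForests {R : Finset V} {v u : V} (hv : v ∉ R) {f : V → V}
    (hf : (f, u) ∈ markedForests (insert v R) R) : update f v u ∈ rootedForests R := by
  simp only [mem_markedForests, mem_rootedForests] at hf
  obtain ⟨⟨hfix, hreach⟩, n, hn⟩ := hf
  have hmiss : ∀ i, f^[i] u ≠ v := by
    intro i hi
    have h₁ : f^[n + i] u = v := by
      rw [iterate_add_apply, hi, iterate_fixed (hfix v (mem_insert_self v R))]
    rw [add_comm, iterate_add_apply, iterate_fixed (hfix _ (mem_insert_of_mem hn))] at h₁
    exact hv (h₁ ▸ hn)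
  have hv_reach : ∃ m, (update f v u)^[m] v ∈ R :=
    ⟨n + 1, by rwa [iterate_succ_apply, update_self, iterate_update_of_forall_ne hmiss]⟩
  rw [mem_rootedForests]
  refine ⟨fun r hr => ?_, fun w => ?_⟩
  · rw [update_of_ne (ne_of_mem_of_not_mem hr hv), hfix r (mem_insert_of_mem hr)]
  · obtain ⟨m, hm⟩ := hreach w
    induction m generalizing w with
    | zero =>
      obtain rfl | hw := mem_insert.1 hm
      · exact hv_reach
      · exact ⟨0, hw⟩
    | succ m ih =>
      by_cases h : w = v
      · exact h ▸ hv_reach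
      · obtain ⟨k, hk⟩ := ih (f w) hm
        exact ⟨k + 1, by rwa [iterate_succ_apply, update_of_ne h]⟩

theorem card_rootedForests_eq_card_markedForests {R : Finset V} {v : V} (hv : v ∉ R) :
    #(rootedForests R) = #(markedForests (insert v R) R) := by
  refine card_bij' (fun f _ => (update f v v, f v)) (fun x _ => update x.1 v x.2)
    (fun f hf => cut_mem_markedForests hv hf) (fun x hx => graft_mem_rootedForests hv hx)
    (fun f _ => by simp) (fun x hx => ?_)
  have hxv : x.1 v = v :=
    (mem_rootedForests.1 (mem_markedForests.1 hx).1).1 v (mem_insert_self v R)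
  ext1
  · simp only [update_idem]
    nth_rewrite 2 [← hxv]
    exact update_eq_self v x.1
  · simp

/-- The number of forests on `n` labeled vertices with `k` prescribed roots is
`k n ^ (n - k - 1)`. -/
theorem card_mul_card_rootedForests (R : Finset V) :
    Fintype.card V * #(rootedForests R) = #R * Fintype.card V ^ #Rᶜ := by
  induction hm : #Rᶜ generalizing R with
  | zero =>
    obtain rfl : R = univ := by simpa using hm
    have : rootedForests (univ : Finset V) = {id} := by
      ext f
      simp only [mem_rootedForests, mem_univ, exists_const, implies_true, and_true, forall_const,
        mem_singleton, funext_iff, id]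
    simp [this]
  | succ m ih =>
    obtain ⟨v, hv⟩ : Rᶜ.Nonempty := card_pos.1 (by omega)
    have hvR : v ∉ R := mem_compl.1 hv
    have hcompl : #(insert v R)ᶜ = m := by
      rw [compl_insert, card_erase_of_mem hv, hm, Nat.add_sub_cancel]
    have hcard := card_mul_card_markedForests (subset_insert v R)
    rw [← card_rootedForests_eq_card_markedForests hvR, ih _ hcompl] at hcard
    refine Nat.eq_of_mul_eq_mul_left (card_pos.2 (insert_nonempty v R)) ?_
    linear_combination Fintype.card V * hcard

end Forests

section Trees

open Finset Function

/-- The graph joining each vertex to its image under `f`. -/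
def parentGraph {V : Type*} (f : V → V) : SimpleGraph V :=
  SimpleGraph.fromRel fun a b => f a = b

variable {V : Type*}

theorem parentGraph_adj {f : V → V} {a b : V} :
    (parentGraph f).Adj a b ↔ a ≠ b ∧ (f a = b ∨ f b = a) :=
  SimpleGraph.fromRel_adj _ a b

theorem parentGraph_reachable_iterate (f : V → V) (v : V) (n : ℕ) :
    (parentGraph f).Reachable v (f^[n] v) := by
  induction n generalizing v with
  | zero => rfl
  | succ n ih =>
    refine SimpleGraph.Reachable.trans ?_ (ih (f v))
    by_cases h : v = f v
    · rw [← h]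
    · exact (parentGraph_adj.2 ⟨h, Or.inl rfl⟩).reachable

theorem exists_adj_dist_lt {G : SimpleGraph V} (hG : G.Connected) {v r : V} (h : v ≠ r) :
    ∃ w, G.Adj v w ∧ G.dist w r < G.dist v r := by
  obtain ⟨p, hp⟩ := hG.exists_walk_length_eq_dist v r
  cases p with
  | nil => exact absurd rfl h
  | cons hadj q =>
    refine ⟨_, hadj, ?_⟩
    rw [← hp, SimpleGraph.Walk.length_cons]
    exact Nat.lt_succ_of_le (SimpleGraph.dist_le q)

variable [Fintype V]

theorem isTree_parentGraph {r : V} {f : V → V} (hf : f ∈ rootedForests {r}) :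
    (parentGraph f).IsTree := by
  classical
  rw [mem_rootedForests] at hf
  have hconn : (parentGraph f).Connected := by
    refine SimpleGraph.connected_iff_exists_forall_reachable _ |>.2 ⟨r, fun v => ?_⟩
    obtain ⟨n, hn⟩ := hf.2 v
    exact (mem_singleton.1 hn ▸ parentGraph_reachable_iterate f v n).symm
  have hedges : (parentGraph f).edgeFinset ⊆ (univ.erase r).image fun v => s(v, f v) := by
    intro e
    induction e with | _ a b
    simp only [SimpleGraph.mem_edgeFinset, SimpleGraph.mem_edgeSet, parentGraph_adj, mem_image,
      mem_erase, mem_univ, and_true]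
    have hr := hf.1 r (mem_singleton_self r)
    rintro ⟨hab, h | h⟩
    · exact ⟨a, fun ha => hab (by rw [← h, ha, hr]), by rw [h]⟩
    · exact ⟨b, fun hb => hab (by rw [← h, hb, hr]), by rw [h, Sym2.eq_swap]⟩
  have hle := (card_le_card hedges).trans card_image_le
  rw [card_erase_of_mem (mem_univ r), card_univ] at hle
  have hge := hconn.card_vert_le_card_edgeSet_add_one
  have hpos : 0 < Fintype.card V := Fintype.card_pos_iff.2 ⟨r⟩
  rw [SimpleGraph.isTree_iff_connected_and_card]
  refine ⟨hconn, ?_⟩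
  simp only [Nat.card_eq_fintype_card, ← SimpleGraph.edgeFinset_card] at hge ⊢
  omega

theorem parentGraph_injOn (r : V) :
    Set.InjOn (parentGraph (V := V)) (rootedForests {r} : Finset (V → V)) := by
  intro f hf g hg hfg
  rw [mem_coe, mem_rootedForests] at hf hg
  have hfr := hf.1 r (mem_singleton_self r)
  have hgr := hg.1 r (mem_singleton_self r)
  have hstep : ∀ v, f v ≠ g v → f (f v) ≠ g (f v) := by
    intro v hv
    have hvr : v ∉ ({r} : Finset V) := by
      rw [mem_singleton]
      rintro rfl
      exact hv (hfr.trans hgr.symm)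
    have hadj : (parentGraph g).Adj v (f v) := by
      rw [← hfg, parentGraph_adj]
      exact ⟨(iterate_succ_ne_self_of_reaches hf.1 hf.2 hvr 0).symm, Or.inl rfl⟩
    obtain ⟨-, h | h⟩ := parentGraph_adj.1 hadj
    · exact absurd h.symm hv
    · rw [h]
      exact iterate_succ_ne_self_of_reaches hf.1 hf.2 hvr 1
  funext v
  by_contra hv
  obtain ⟨n, hn⟩ := hf.2 v
  have hall : ∀ n, f (f^[n] v) ≠ g (f^[n] v) := by
    intro n
    induction n with
    | zero => exact hv
    | succ n ih => rw [iterate_succ_apply']; exact hstep _ ih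
  refine hall n ?_
  rw [mem_singleton.1 hn, hfr, hgr]

theorem exists_parentGraph_eq {T : SimpleGraph V} (hT : T.IsTree) (r : V) :
    ∃ f ∈ rootedForests {r}, parentGraph f = T := by
  classical
  choose! f hadj hlt using fun v (h : v ≠ r) => exists_adj_dist_lt hT.connected h
  have hmem : update f r r ∈ rootedForests {r} := by
    rw [mem_rootedForests]
    refine ⟨by simp, fun v => ?_⟩
    induction hd : T.dist v r using Nat.strong_induction_on generalizing v with
    | _ d ih =>
      by_cases h : v = r
      · exact ⟨0, by simp [h]⟩
      · obtain ⟨n, hn⟩ := ih _ (hd ▸ hlt v h) (f v) rfl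
        exact ⟨n + 1, by rwa [iterate_succ_apply, update_of_ne h]⟩
  have hle : parentGraph (update f r r) ≤ T := by
    have haux : ∀ a b, a ≠ b → update f r r a = b → T.Adj a b := by
      intro a b hab h
      by_cases har : a = r
      · subst har
        simp [hab] at h
      · rw [update_of_ne har] at h
        exact h ▸ hadj a har
    intro a b hab
    obtain ⟨hne, h | h⟩ := parentGraph_adj.1 hab
    · exact haux a b hne h
    · exact (haux b a hne.symm h).symm
  refine ⟨_, hmem, ?_⟩
  rw [← SimpleGraph.edgeFinset_inj]
  refine eq_of_subset_of_card_le (SimpleGraph.edgeFinset_mono hle) ?_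
  have h₁ := hT.card_edgeFinset
  have h₂ := (isTree_parentGraph hmem).card_edgeFinset
  omega

theorem card_isTree_eq_card_rootedForests (r : V) :
    Nat.card {T : SimpleGraph V // T.IsTree} = #(rootedForests {r}) := by
  rw [← Nat.card_eq_finsetCard]
  refine (Nat.card_congr (Equiv.ofBijective
    (fun f : rootedForests {r} => ⟨parentGraph f.1, isTree_parentGraph f.2⟩) ⟨?_, ?_⟩)).symm
  · intro f g hfg
    exact Subtype.ext (parentGraph_injOn r f.2 g.2 (congrArg Subtype.val hfg))
  · rintro ⟨T, hT⟩
    obtain ⟨f, hf, rfl⟩ := exists_parentGraph_eq hT r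
    exact ⟨⟨f, hf⟩, rfl⟩

end Trees

/-- Cayley's formula: the number of spanning trees of the complete graph on `p`
labeled vertices is `p^(p-2)`, for `p ≥ 2`. -/
theorem cayley_formula (p : ℕ) (hp : 2 ≤ p) :
    numSpanningTrees (⊤ : SimpleGraph (Fin p)) = p ^ (p - 2) := by
  obtain ⟨q, rfl⟩ := Nat.exists_eq_add_of_le' hp
  have hforests := card_mul_card_rootedForests ({0} : Finset (Fin (q + 2)))
  rw [Finset.card_compl, Finset.card_singleton, Fintype.card_fin, one_mul, Nat.add_sub_assoc
    (by norm_num), pow_succ'] at hforests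
  simp only [numSpanningTrees, le_top, true_and, Nat.add_sub_cancel]
  rw [card_isTree_eq_card_rootedForests 0]
  exact Nat.eq_of_mul_eq_mul_left (by positivity) hforests
end

section
/- (Gallai's theorem on matchings and edge covers.) Let G be a connected simple graph with p vertices, p > 1. If a maximum matching of G has m edges and a minimum edge cover of G has n edges, then m + n = p. -/
/-- A set of edges of a graph `G` is a matching if all its members are edges of
`G` and no two distinct members share a vertex. -/
def IsMatchingSet {V : Type} (G : SimpleGraph V) (M : Set (Sym2 V)) : Prop :=
  M ⊆ G.edgeSet ∧ ∀ e ∈ M, ∀ f ∈ M, e ≠ f → ∀ v : V, ¬(v ∈ e ∧ v ∈ f)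

/-- A set of edges of a graph `G` is an edge cover if all its members are edges
of `G` and every vertex is an endpoint of some member. -/
def IsEdgeCoverSet {V : Type} (G : SimpleGraph V) (N : Set (Sym2 V)) : Prop :=
  N ⊆ G.edgeSet ∧ ∀ v : V, ∃ e ∈ N, v ∈ e

section Gallai

variable {V : Type} {G : SimpleGraph V} {M N : Set (Sym2 V)}

/-- The set of vertices covered by a set of edges. -/
def coveredVerts (M : Set (Sym2 V)) : Set V := {v | ∃ e ∈ M, v ∈ e}

theorem IsMatchingSet.ncard_coveredVerts [Finite V] (hM : IsMatchingSet G M) :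
    (coveredVerts M).ncard = 2 * M.ncard := by
  classical
  have hMfin : M.Finite := M.toFinite
  have hcov : coveredVerts M = (hMfin.toFinset.biUnion Sym2.toFinset : Finset V) := by
    ext v
    simp [coveredVerts]
  rw [hcov, Set.ncard_coe_finset, Finset.card_biUnion, Set.ncard_eq_toFinset_card M hMfin,
    Finset.sum_const_nat (m := 2), mul_comm]
  · intro e he
    exact Sym2.card_toFinset_of_not_isDiag e
      (G.not_isDiag_of_mem_edgeSet (hM.1 (hMfin.mem_toFinset.mp he)))
  · intro e he f hf hef
    rw [Function.onFun, Finset.disjoint_left]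
    intro v hve hvf
    rw [Sym2.mem_toFinset] at hve hvf
    exact hM.2 e (hMfin.mem_toFinset.mp he) f (hMfin.mem_toFinset.mp hf) hef v ⟨hve, hvf⟩

theorem IsMatchingSet.insert {e : Sym2 V} (hM : IsMatchingSet G M) (he : e ∈ G.edgeSet)
    (hdisj : ∀ v ∈ e, v ∉ coveredVerts M) : IsMatchingSet G (insert e M) := by
  refine ⟨Set.insert_subset he hM.1, ?_⟩
  rintro a (rfl | ha) b (rfl | hb) hab v ⟨hva, hvb⟩
  · exact hab rfl
  · exact hdisj v hva ⟨b, hb, hvb⟩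
  · exact hdisj v hvb ⟨a, ha, hva⟩
  · exact hM.2 a ha b hb hab v ⟨hva, hvb⟩

/-- A matching of a graph without isolated vertices extends to an edge cover by adding one edge at
each vertex it misses. -/
theorem IsMatchingSet.exists_edgeCover [Finite V] (hM : IsMatchingSet G M)
    (hG : ∀ v, ∃ w, G.Adj v w) :
    ∃ N, IsEdgeCoverSet G N ∧ M.ncard + N.ncard ≤ Nat.card V := by
  choose g hg using hG
  refine ⟨M ∪ (fun v => s(v, g v)) '' (coveredVerts M)ᶜ, ⟨?_, fun v => ?_⟩, ?_⟩
  · rintro e (he | ⟨v, -, rfl⟩)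
    · exact hM.1 he
    · exact hg v
  · by_cases hv : v ∈ coveredVerts M
    · obtain ⟨e, he, hve⟩ := hv
      exact ⟨e, Or.inl he, hve⟩
    · exact ⟨s(v, g v), Or.inr ⟨v, hv, rfl⟩, Sym2.mem_mk_left _ _⟩
  · have hunion := Set.ncard_union_le M ((fun v => s(v, g v)) '' (coveredVerts M)ᶜ)
    have himage := Set.ncard_image_le (f := fun v => s(v, g v)) (coveredVerts M)ᶜ.toFinite
    have hcompl := Set.ncard_add_ncard_compl (coveredVerts M)
    rw [hM.ncard_coveredVerts] at hcompl
    omega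

/-- Every edge cover `N` contains a matching with at least `|V| - |N|` edges. -/
theorem IsEdgeCoverSet.exists_matching [Finite V] (hN : IsEdgeCoverSet G N) :
    ∃ M, IsMatchingSet G M ∧ Nat.card V ≤ M.ncard + N.ncard := by
  obtain ⟨M, ⟨hM, hMN⟩, hmax⟩ := (Set.toFinite {M | IsMatchingSet G M ∧ M ⊆ N}).exists_maximal
    ⟨∅, ⟨⟨Set.empty_subset _, by simp⟩, Set.empty_subset _⟩⟩
  refine ⟨M, hM, ?_⟩
  choose g hgN hg using hN.2
  have hgM : ∀ v ∉ coveredVerts M, g v ∉ M := fun v hv h => hv ⟨g v, h, hg v⟩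
  have hinj : Set.InjOn g (coveredVerts M)ᶜ := by
    intro u hu v hv huv
    by_contra hne
    have hgu : g u = s(u, v) := (Sym2.mem_and_mem_iff hne).mp ⟨hg u, huv ▸ hg v⟩
    refine hgM u hu (hmax ⟨hM.insert (hN.1 (hgN u)) ?_, Set.insert_subset (hgN u) hMN⟩
      (Set.subset_insert _ _) (Set.mem_insert _ _))
    intro w hw
    rw [hgu, Sym2.mem_iff] at hw
    rcases hw with rfl | rfl
    exacts [hu, hv]
  have hdisj : Disjoint M (g '' (coveredVerts M)ᶜ) := by
    rw [Set.disjoint_right]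
    rintro _ ⟨v, hv, rfl⟩
    exact hgM v hv
  have hsub : M ∪ g '' (coveredVerts M)ᶜ ⊆ N :=
    Set.union_subset hMN (Set.image_subset_iff.mpr fun v _ => hgN v)
  have hle := Set.ncard_le_ncard hsub
  rw [Set.ncard_union_eq hdisj, hinj.ncard_image] at hle
  have hcompl := Set.ncard_add_ncard_compl (coveredVerts M)
  rw [hM.ncard_coveredVerts] at hcompl
  omega

end Gallai

/-- Gallai's theorem: in a connected simple graph with `p > 1` vertices, if a
maximum matching has `m` edges and a minimum edge cover has `n` edges, then
`m + n = p`. -/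
theorem matching_add_edgeCover {V : Type} [Fintype V] (G : SimpleGraph V)
    (hconn : G.Connected) (hp : 1 < Fintype.card V)
    (M N : Set (Sym2 V)) (m n : ℕ)
    (hM : IsMatchingSet G M) (hMcard : M.ncard = m)
    (hMmax : ∀ M' : Set (Sym2 V), IsMatchingSet G M' → M'.ncard ≤ m)
    (hN : IsEdgeCoverSet G N) (hNcard : N.ncard = n)
    (hNmin : ∀ N' : Set (Sym2 V), IsEdgeCoverSet G N' → n ≤ N'.ncard) :
    m + n = Fintype.card V := by
  have : Nontrivial V := Fintype.one_lt_card_iff_nontrivial.mp hp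
  obtain ⟨N', hN', hle⟩ := hM.exists_edgeCover hconn.preconnected.exists_adj_of_nontrivial
  obtain ⟨M', hM', hge⟩ := hN.exists_matching
  have hn := hNmin N' hN'
  have hm := hMmax M' hM'
  rw [Nat.card_eq_fintype_card] at hle hge
  omega
end

section
/- Let G be a simple graph with p vertices. Then there exists a monic polynomial P with integer coefficients, of degree p and with zero constant term, such that for every natural number x, the number of proper colorings of G with x colors equals P evaluated at x. -/
/-- The setoids on the vertices of `G` whose classes are independent sets of `G`. -/
abbrev SimpleGraph.StableSetoid {V : Type*} (G : SimpleGraph V) : Type _ :=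
  {s : Setoid V // ∀ ⦃u v : V⦄, G.Adj u v → ¬ s u v}

/-- Injectively coloring the classes of a partition of the vertices into independent sets gives a
proper coloring of the graph. -/
def SimpleGraph.StableSetoid.coloring {V α : Type*} {G : SimpleGraph V}
    (p : Σ s : G.StableSetoid, Quotient s.1 ↪ α) : G.Coloring α :=
  SimpleGraph.Coloring.mk (fun v => p.2 (Quotient.mk p.1.1 v)) fun h e =>
    p.1.2 h (Quotient.exact (p.2.injective e))

theorem SimpleGraph.StableSetoid.coloring_bijective {V α : Type*} (G : SimpleGraph V) :
    Function.Bijective (SimpleGraph.StableSetoid.coloring (α := α) (G := G)) := by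
  constructor
  · rintro ⟨⟨s, hs⟩, f⟩ ⟨⟨t, ht⟩, g⟩ h
    have hfg (v : V) : f (Quotient.mk s v) = g (Quotient.mk t v) := DFunLike.congr_fun h v
    obtain rfl : s = t := by
      ext u v
      rw [← Quotient.eq (r := s), ← Quotient.eq (r := t), ← f.injective.eq_iff, hfg, hfg,
        g.injective.eq_iff]
    obtain rfl : f = g := by
      ext q
      induction q using Quotient.inductionOn with
      | h v => exact hfg v
    rfl
  · intro C
    exact ⟨⟨⟨Setoid.ker C, fun _ _ h => C.valid h⟩, Setoid.kerLift C, Setoid.kerLift_injective C⟩,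
      rfl⟩

theorem Setoid.natCard_quotient_lt {V : Type*} [Finite V] {s : Setoid V} (hs : s ≠ ⊥) :
    Nat.card (Quotient s) < Nat.card V := by
  refine (Nat.card_le_card_of_surjective _ Quotient.mk_surjective).lt_of_ne fun h => hs ?_
  have hinj : Function.Injective (Quotient.mk s) :=
    ((Nat.bijective_iff_surjective_and_card _).2 ⟨Quotient.mk_surjective, h.symm⟩).injective
  rw [eq_bot_iff]
  exact fun u v huv => hinj (Quotient.sound huv)

/-- The chromatic polynomial: for a simple graph `G` on `p` vertices (graphs
have a nonempty vertex set), there is a monic polynomial `P` of degree `p` with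
integer coefficients and zero constant term such that for every natural number
`x`, the number of proper colorings of `G` with `x` colors is `P(x)`. -/
theorem exists_chromatic_polynomial {V : Type} [Fintype V] [Nonempty V]
    (G : SimpleGraph V) :
    ∃ P : Polynomial ℤ, P.Monic ∧ P.natDegree = Fintype.card V ∧ P.coeff 0 = 0 ∧
      ∀ x : ℕ, (Nat.card (G.Coloring (Fin x)) : ℤ) = P.eval (x : ℤ) := by
  classical
  have : Finite (Setoid V) :=
    Finite.of_injective (fun s : Setoid V => (s : V → V → Prop)) fun s t h => Setoid.ext fun u v =>
      iff_of_eq (congrFun₂ h u v)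
  have := Fintype.ofFinite G.StableSetoid
  let d (s : G.StableSetoid) : ℕ := Nat.card (Quotient s.1)
  let b : G.StableSetoid := ⟨⊥, fun u v h e => h.ne e⟩
  have hb : d b = Fintype.card V := by
    rw [← Nat.card_eq_fintype_card]
    exact (Nat.card_congr
      (Equiv.ofBijective (Quotient.mk ⊥) ⟨fun u v h => Quotient.exact h,
        Quotient.mk_surjective⟩)).symm
  have hdeg (n : ℕ) : (descPochhammer ℤ n).degree = n := by
    rw [Polynomial.degree_eq_natDegree (monic_descPochhammer ℤ n).ne_zero, descPochhammer_natDegree]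
  have hlt : (∑ s ∈ Finset.univ.erase b, descPochhammer ℤ (d s)).degree
      < (descPochhammer ℤ (d b)).degree := by
    refine (Polynomial.degree_sum_le _ _).trans_lt ?_
    rw [Finset.sup_lt_iff (by rw [hdeg]; exact WithBot.bot_lt_coe _)]
    intro s hs
    rw [hdeg, hdeg, hb, ← Nat.card_eq_fintype_card, Nat.cast_lt]
    exact Setoid.natCard_quotient_lt fun h => Finset.ne_of_mem_erase hs (Subtype.ext h)
  have hsum := Finset.add_sum_erase Finset.univ (fun s => descPochhammer ℤ (d s))
    (Finset.mem_univ b)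
  refine ⟨∑ s : G.StableSetoid, descPochhammer ℤ (d s), ?_, ?_, ?_, fun x => ?_⟩
  · rw [← hsum]
    exact (monic_descPochhammer ℤ _).add_of_left hlt
  · rw [← hsum, Polynomial.natDegree_add_eq_left_of_degree_lt hlt, descPochhammer_natDegree, hb]
  · rw [Polynomial.coeff_zero_eq_eval_zero, Polynomial.eval_finsetSum]
    refine Finset.sum_eq_zero fun s _ => descPochhammer_ne_zero_eval_zero ℤ ?_
    have : Nonempty (Quotient s.1) := Nonempty.map (Quotient.mk s.1) inferInstance
    exact Nat.card_pos.ne'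
  · rw [← Nat.card_congr (Equiv.ofBijective _
      (SimpleGraph.StableSetoid.coloring_bijective G)), Nat.card_sigma, Polynomial.eval_finsetSum,
      Nat.cast_sum]
    refine Finset.sum_congr rfl fun s _ => ?_
    have := Fintype.ofFinite (Quotient s.1)
    rw [descPochhammer_eval_eq_descFactorial, Nat.card_eq_fintype_card, Fintype.card_embedding_eq,
      Fintype.card_fin, ← Nat.card_eq_fintype_card]
end

section
/- Let G be a connected simple graph whose edges are weighted by real numbers, and let T be a spanning tree of G. Then T has minimal weight among all spanning trees of G if and only if weight(T) ≤ weight(T') for every neighbor T' of T, i.e., for every spanning tree T' of the form T' = T − e + e' obtained from T by removing one edge e of T and adding one edge e' of G. -/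
namespace SimpleGraph

variable {V : Type*}

lemma edgeSet_fromEdgeSet_insert_diff (T : SimpleGraph V) {x y : V} (hxy : x ≠ y)
    (e : Sym2 V) :
    (fromEdgeSet (insert s(x, y) (T.edgeSet \ {e}))).edgeSet =
      insert s(x, y) (T.edgeSet \ {e}) := by
  rw [edgeSet_fromEdgeSet, sdiff_eq_left, Set.disjoint_left]
  rintro f (rfl | hf) hd
  · exact hxy (by simpa using hd)
  · exact T.not_isDiag_of_mem_edgeSet hf.1 hd

/-- Replacing an edge `e` of a tree by an edge joining the two components of `T - e`
yields a tree. -/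
lemma IsTree.fromEdgeSet_insert_diff [Finite V] {T : SimpleGraph V} (hT : T.IsTree)
    {e : Sym2 V} (he : e ∈ T.edgeSet) {x y : V}
    (hxy : ¬ (T.deleteEdges {e}).Reachable x y) :
    (fromEdgeSet (insert s(x, y) (T.edgeSet \ {e}))).IsTree := by
  have hne : x ≠ y := by
    rintro rfl
    exact hxy .rfl
  have hedge := edgeSet_fromEdgeSet_insert_diff T hne e
  have hmem : s(x, y) ∉ T.edgeSet \ {e} := fun h ↦
    hxy (Adj.reachable (by rwa [← mem_edgeSet, edgeSet_deleteEdges]))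
  set H := fromEdgeSet (insert s(x, y) (T.edgeSet \ {e})) with hH
  have hacyc : H.IsAcyclic := by
    have hsup : H = T.deleteEdges {e} ⊔ edge x y := by
      rw [← edgeSet_inj, hedge, edgeSet_sup, edgeSet_deleteEdges, edgeSet_edge_of_ne hne,
        Set.union_singleton]
    rw [hsup]
    exact (hT.isAcyclic.anti (deleteEdges_le _)).sup_edge_of_not_reachable hxy
  have hcard : H.edgeSet.ncard = T.edgeSet.ncard := by
    rw [hedge, Set.ncard_insert_of_notMem hmem (Set.toFinite _),
      Set.ncard_sdiff_singleton_add_one he (Set.toFinite _)]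
  have : Nonempty V := ⟨x⟩
  obtain ⟨F, hHF, -, hF⟩ := connected_top.exists_isTree_le_of_le_of_isAcyclic le_top hacyc
  have hFT : F.edgeSet.ncard = T.edgeSet.ncard :=
    Nat.add_right_cancel
      ((isTree_iff_connected_and_card.1 hF).2.trans (isTree_iff_connected_and_card.1 hT).2.symm)
  have hHF' : H = F := edgeSet_inj.1 <|
    Set.eq_of_subset_of_ncard_le (edgeSet_mono hHF) (hFT.trans hcard.symm).le (Set.toFinite _)
  rwa [hHF']

/-- Symmetric exchange: every edge `xy` of a tree `T'` can be exchanged with some edge `uv` of a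
tree `T` so that both `T - uv + xy` and `T' - xy + uv` are trees. -/
lemma IsTree.exists_symm_exchange {T T' : SimpleGraph V} (hT : T.IsTree)
    (hT' : T'.IsTree) {x y : V} (hxy : T'.Adj x y) :
    ∃ u v, T.Adj u v ∧ ¬ (T.deleteEdges {s(u, v)}).Reachable x y ∧
      ¬ (T'.deleteEdges {s(x, y)}).Reachable u v := by
  obtain ⟨p, hp, hpu⟩ := hT.existsUnique_path x y
  have hbridge : ¬ (T'.deleteEdges {s(x, y)}).Reachable x y :=
    isBridge_iff.1 (isAcyclic_iff_forall_isBridge.1 hT'.isAcyclic hxy)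
  obtain ⟨d, hd, hd₁, hd₂⟩ := p.exists_boundary_dart
    {z | (T'.deleteEdges {s(x, y)}).Reachable x z} .rfl hbridge
  refine ⟨d.fst, d.snd, d.adj, fun h ↦ ?_, fun h ↦ hd₂ (hd₁.trans h)⟩
  classical
  obtain ⟨q, hq⟩ := reachable_deleteEdges_iff_exists_walk.1 h
  have hqp : q.bypass = p := hpu _ q.bypass_isPath
  exact hq (q.edges_bypass_subset_edges (hqp ▸ List.mem_map_of_mem hd))

lemma finsum_mem_edgeSet_exchange [Finite V] {M : Type*} [AddCommGroup M] (w : Sym2 V → M)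
    {T : SimpleGraph V} {e : Sym2 V} (he : e ∈ T.edgeSet) {x y : V}
    (hxy : ¬ (T.deleteEdges {e}).Reachable x y) :
    ∑ᶠ f ∈ (fromEdgeSet (insert s(x, y) (T.edgeSet \ {e}))).edgeSet, w f =
      ∑ᶠ f ∈ T.edgeSet, w f - w e + w s(x, y) := by
  have hne : x ≠ y := by
    rintro rfl
    exact hxy .rfl
  have hmem : s(x, y) ∉ T.edgeSet \ {e} := fun h ↦
    hxy (Adj.reachable (by rwa [← mem_edgeSet, edgeSet_deleteEdges]))
  have hT := finsum_mem_insert w (a := e) (s := T.edgeSet \ {e}) (by simp) (Set.toFinite _)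
  rw [Set.insert_sdiff_singleton, Set.insert_eq_of_mem he] at hT
  rw [edgeSet_fromEdgeSet_insert_diff T hne, finsum_mem_insert w hmem (Set.toFinite _), hT]
  abel

lemma fromEdgeSet_insert_diff_le {G T : SimpleGraph V} (hTG : T ≤ G) {x y : V}
    (hxy : G.Adj x y) (e : Sym2 V) :
    fromEdgeSet (insert s(x, y) (T.edgeSet \ {e})) ≤ G := by
  rw [← edgeSet_subset_edgeSet, edgeSet_fromEdgeSet_insert_diff T hxy.ne]
  exact Set.insert_subset hxy (Set.sdiff_subset.trans (edgeSet_mono hTG))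

end SimpleGraph

/-- A spanning tree `T` of a connected weighted graph `G` has minimal weight
among all spanning trees if and only if `weight T ≤ weight T'` for every
neighbor `T'` of `T`, i.e. every spanning tree of the form `T - e + e'` with
`e` an edge of `T` and `e'` an edge of `G`. -/
theorem minimal_spanning_tree_iff_local {V : Type} [Fintype V]
    (G : SimpleGraph V) (hG : G.Connected) (w : Sym2 V → ℝ)
    (T : SimpleGraph V) (hT : T ≤ G ∧ T.IsTree) :
    (∀ T' : SimpleGraph V, T' ≤ G ∧ T'.IsTree →
        (∑ᶠ e ∈ T.edgeSet, w e) ≤ ∑ᶠ e ∈ T'.edgeSet, w e)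
    ↔ (∀ T' : SimpleGraph V, T' ≤ G ∧ T'.IsTree →
        (∃ e ∈ T.edgeSet, ∃ e' ∈ G.edgeSet,
          T' = SimpleGraph.fromEdgeSet (insert e' (T.edgeSet \ {e}))) →
        (∑ᶠ e ∈ T.edgeSet, w e) ≤ ∑ᶠ e ∈ T'.edgeSet, w e) := by
  refine ⟨fun h T' hT' _ ↦ h T' hT', fun hloc T' hT' ↦ ?_⟩
  induction hn : (T'.edgeSet \ T.edgeSet).ncard using Nat.strong_induction_on generalizing T' with
  | _ n ih =>
    by_cases hsub : T' ≤ T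
    · have hle : T ≤ T' :=
        (SimpleGraph.isTree_iff_minimal_connected.1 hT.2).2 hT'.2.connected hsub
      rw [le_antisymm hsub hle]
    obtain ⟨x, y, hxy', hxyT⟩ : ∃ x y, T'.Adj x y ∧ ¬ T.Adj x y := by
      simpa [SimpleGraph.le_iff_adj] using hsub
    obtain ⟨u, v, huv, hT_cut, hT'_cut⟩ := hT.2.exists_symm_exchange hT'.2 hxy'
    have hstep := hloc _
      ⟨SimpleGraph.fromEdgeSet_insert_diff_le hT.1 (hT'.1 hxy') _,
        hT.2.fromEdgeSet_insert_diff huv hT_cut⟩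
      ⟨s(u, v), huv, s(x, y), hT'.1 hxy', rfl⟩
    rw [SimpleGraph.finsum_mem_edgeSet_exchange w huv hT_cut] at hstep
    have hrec := ih _ ?_ _
      ⟨SimpleGraph.fromEdgeSet_insert_diff_le hT'.1 (hT.1 huv) s(x, y),
        hT'.2.fromEdgeSet_insert_diff hxy' hT'_cut⟩ rfl
    · rw [SimpleGraph.finsum_mem_edgeSet_exchange w hxy' hT'_cut] at hrec
      linarith
    · rw [← hn, SimpleGraph.edgeSet_fromEdgeSet_insert_diff T' huv.ne,
        Set.insert_sdiff_of_mem _ (T.mem_edgeSet.2 huv)]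
      refine Set.ncard_lt_ncard ⟨Set.sdiff_subset_sdiff_left Set.sdiff_subset, fun h ↦ ?_⟩
        (Set.toFinite _)
      exact (h (⟨hxy', hxyT⟩ : s(x, y) ∈ T'.edgeSet \ T.edgeSet)).1.2 rfl
end

section
/- (Exchange lemma.) Let S and T be spanning trees of a connected simple graph G. Then for every edge s of S that is not an edge of T, there exists an edge t of T that is not an edge of S such that both S − s + t and T + s − t are spanning trees of G. -/
namespace SimpleGraph

/-- Replacing an edge `ab` of a tree by an edge joining two vertices that are separated by the
deletion of `ab` gives a tree. -/
lemma IsTree.deleteEdges_sup_edge {V : Type*} {H : SimpleGraph V} (hH : H.IsTree) {a b c d : V}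
    (hab : H.Adj a b) (hcd : ¬ (H.deleteEdges {s(a, b)}).Reachable c d) :
    (H.deleteEdges {s(a, b)} ⊔ edge c d).IsTree := by
  have hacyc : (H.deleteEdges {s(a, b)} ⊔ edge c d).IsAcyclic :=
    (hH.isAcyclic.anti (deleteEdges_le _)).sup_edge_of_not_reachable hcd
  set K := H.deleteEdges {s(a, b)} ⊔ edge c d with hK
  have hne : c ≠ d := by rintro rfl; exact hcd .rfl
  have hcdK : K.Adj c d := by simp [hK, edge_adj, hne]
  have hHK : H ≤ K ⊔ edge a b := by
    intro x y hxy
    by_cases h : s(x, y) = s(a, b)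
    · right
      simpa [edge_adj, hxy.ne] using h
    · left; left
      simpa [deleteEdges_adj, hxy] using h
  have hreach : K.Reachable a b := by
    by_contra hn
    have hKH : K ⊔ edge a b ≤ H :=
      (isTree_iff_maximal_isAcyclic.1 hH).2.2 (hacyc.sup_edge_of_not_reachable hn) hHK
    refine hcd (Adj.reachable ?_)
    rw [deleteEdges_adj]
    refine ⟨hKH (Or.inl hcdK), fun h ↦ hn ?_⟩
    rw [Set.mem_singleton_iff] at h
    exact Adj.reachable (by rwa [← mem_edgeSet, ← h])
  have hadj {x y : V} (hxy : H.Adj x y) : K.Reachable x y := by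
    rcases hHK hxy with h | h
    · exact h.reachable
    · rcases (edge_adj ..).1 h with ⟨⟨rfl, rfl⟩ | ⟨rfl, rfl⟩, -⟩
      exacts [hreach, hreach.symm]
  have := hH.connected.nonempty
  refine ⟨⟨fun x y ↦ ?_⟩, hacyc⟩
  obtain ⟨p⟩ := hH.connected x y
  induction p with
  | nil => exact .rfl
  | cons h _ ih => exact (hadj h).trans ih

lemma fromEdgeSet_insert_edgeSet_diff_singleton {V : Type*} (H : SimpleGraph V) (e : Sym2 V)
    (c d : V) :
    fromEdgeSet (insert s(c, d) (H.edgeSet \ {e})) = H.deleteEdges {e} ⊔ edge c d := by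
  ext x y
  have := @Adj.ne V H x y
  simp only [fromEdgeSet_adj, Set.mem_insert_iff, Set.mem_sdiff, mem_edgeSet,
    Set.mem_singleton_iff, sup_adj, deleteEdges_adj, edge_adj, Sym2.eq_iff]
  grind

/-- Deleting an edge of a path in an acyclic graph separates the ends of the path. -/
lemma IsAcyclic.not_reachable_deleteEdges_of_mem_edges {V : Type*} {H : SimpleGraph V}
    (hH : H.IsAcyclic) {u v : V} {p : H.Walk u v} (hp : p.IsPath) {e : Sym2 V}
    (he : e ∈ p.edges) : ¬ (H.deleteEdges {e}).Reachable u v := by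
  intro h
  obtain ⟨q, hq⟩ := h.exists_isPath
  have heq := congrArg Subtype.val
    ((hH.subsingleton_path u v).elim ⟨p, hp⟩ ⟨q.mapLe (deleteEdges_le _), hq.mapLe _⟩)
  simp only at heq
  rw [heq, Walk.edges_mapLe_eq_edges] at he
  have := q.edges_subset_edgeSet he
  simp at this

end SimpleGraph

/-- Exchange lemma: if `S` and `T` are spanning trees of a connected graph `G`,
then for every edge `s` of `S` not in `T` there is an edge `t` of `T` not in `S`
such that `S - s + t` and `T + s - t` are both spanning trees of `G`. -/
theorem spanning_tree_exchange {V : Type} [Fintype V]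
    (G : SimpleGraph V) (hG : G.Connected)
    (S T : SimpleGraph V) (hS : S ≤ G ∧ S.IsTree) (hT : T ≤ G ∧ T.IsTree)
    (s : Sym2 V) (hsS : s ∈ S.edgeSet) (hsT : s ∉ T.edgeSet) :
    ∃ t ∈ T.edgeSet, t ∉ S.edgeSet ∧
      (SimpleGraph.fromEdgeSet (insert t (S.edgeSet \ {s})) ≤ G ∧
        (SimpleGraph.fromEdgeSet (insert t (S.edgeSet \ {s}))).IsTree) ∧
      (SimpleGraph.fromEdgeSet (insert s (T.edgeSet \ {t})) ≤ G ∧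
        (SimpleGraph.fromEdgeSet (insert s (T.edgeSet \ {t}))).IsTree) := by
  induction s with | h u v
  have huvS : S.Adj u v := hsS
  have hsep : ¬ (S.deleteEdges {s(u, v)}).Reachable u v :=
    SimpleGraph.isAcyclic_iff_forall_isBridge.1 hS.2.isAcyclic hsS
  obtain ⟨p, hp⟩ := (hT.2.connected u v).exists_isPath
  obtain ⟨⟨⟨x, y⟩, hxy⟩, hdp, hx, hy⟩ := p.exists_boundary_dart
    {w | (S.deleteEdges {s(u, v)}).Reachable u w} .rfl hsep
  have hyx : ¬ (S.deleteEdges {s(u, v)}).Reachable x y := fun h ↦ hy (hx.trans h)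
  have hmem : s(x, y) ∈ p.edges := List.mem_map_of_mem hdp
  have hle {H : SimpleGraph V} (hH : H ≤ G) (e : Sym2 V) {c d : V} (hcd : G.Adj c d) :
      H.deleteEdges {e} ⊔ SimpleGraph.edge c d ≤ G :=
    sup_le ((H.deleteEdges_le _).trans hH) ((SimpleGraph.edge_le_iff _).2 (.inr hcd))
  refine ⟨s(x, y), hxy, fun h ↦ hyx (SimpleGraph.Adj.reachable ?_), ?_, ?_⟩
  · refine (SimpleGraph.deleteEdges_adj).2 ⟨h, fun h' ↦ hsT ?_⟩
    rw [Set.mem_singleton_iff] at h'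
    rwa [← h']
  · rw [SimpleGraph.fromEdgeSet_insert_edgeSet_diff_singleton]
    exact ⟨hle hS.1 _ (hT.1 hxy), hS.2.deleteEdges_sup_edge huvS hyx⟩
  · rw [SimpleGraph.fromEdgeSet_insert_edgeSet_diff_singleton]
    exact ⟨hle hT.1 _ (hS.1 huvS), hT.2.deleteEdges_sup_edge hxy
      (hT.2.isAcyclic.not_reachable_deleteEdges_of_mem_edges hp hmem)⟩
end

section
/- There exists a Rado graph; specifically, the simple graph R on vertex set ℕ = {0, 1, 2, …}, in which for i < j the vertices i and j are adjacent exactly when the i-th bit of the binary representation of j equals 1, satisfies the Rado property. -/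
/-- The graph on `ℕ` in which, for `i < j`, vertices `i` and `j` are adjacent
exactly when the `i`-th bit of the binary representation of `j` is `1`. -/
def radoGraph : SimpleGraph ℕ :=
  SimpleGraph.fromRel fun i j => i < j ∧ Nat.testBit j i = true

/-- Every finite set of naturals is the set of binary digits equal to `1` of some natural. -/
theorem exists_testBit_eq_true_iff_mem (S : Finset ℕ) :
    ∃ n : ℕ, ∀ i, n.testBit i = true ↔ i ∈ S := by
  induction S using Finset.induction_on with
  | empty => exact ⟨0, by simp⟩
  | insert a S _ ih =>
    obtain ⟨n, hn⟩ := ih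
    refine ⟨n ||| 2 ^ a, fun i => ?_⟩
    rw [Nat.testBit_or, Nat.testBit_two_pow, Bool.or_eq_true, hn, decide_eq_true_iff,
      Finset.mem_insert, or_comm, eq_comm]

/-- Existence of a Rado graph: the graph `radoGraph` satisfies the Rado
property — for every two finite disjoint sets of vertices `V` and `W` there is
a vertex `v ∉ V ∪ W` adjacent to every vertex of `V` and to no vertex of `W`. -/
theorem radoGraph_radoProperty (V W : Finset ℕ) (h : Disjoint V W) :
    ∃ v : ℕ, v ∉ V ∧ v ∉ W ∧ (∀ u ∈ V, radoGraph.Adj v u) ∧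
      ∀ w ∈ W, ¬ radoGraph.Adj v w := by
  obtain ⟨N, hN⟩ := (V ∪ W).exists_le
  obtain ⟨v, hv⟩ := exists_testBit_eq_true_iff_mem (insert (N + 1) V)
  have hNv : N + 1 < v :=
    Nat.lt_two_pow_self.trans_le (Nat.ge_two_pow_of_testBit ((hv _).2 (by simp)))
  have hlt : ∀ u ∈ V ∪ W, u < v := fun u hu => by
    have := hN u hu
    omega
  refine ⟨v, fun hV => (hlt v (Finset.mem_union_left _ hV)).false,
    fun hW => (hlt v (Finset.mem_union_right _ hW)).false, fun u hu => ?_, fun w hw hadj => ?_⟩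
  · have huv := hlt u (Finset.mem_union_left _ hu)
    exact ⟨huv.ne', Or.inr ⟨huv, (hv u).2 (Finset.mem_insert_of_mem hu)⟩⟩
  · have hwv := hlt w (Finset.mem_union_right _ hw)
    rcases hadj.2 with ⟨hvw, _⟩ | ⟨_, hbit⟩
    · exact hwv.asymm hvw
    · rcases Finset.mem_insert.1 ((hv w).1 hbit) with rfl | hwV
      · exact Nat.not_succ_le_self N (hN _ (Finset.mem_union_right _ hw))
      · exact Finset.disjoint_left.1 h hwV hw
end

section
/- Let R be a Rado graph. Then every countable simple graph G (finite or infinite) is isomorphic to an induced subgraph of R; that is, there is an injective map f from the vertices of G to the vertices of R such that f(u) and f(v) are adjacent in R if and only if u and v are adjacent in G. -/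
/-- A graph has the Rado property if for every two finite disjoint sets of
vertices `V` and `W` there is a vertex `v ∉ V ∪ W` adjacent to every vertex of
`V` and to no vertex of `W`. -/
def RadoProperty {α : Type} (G : SimpleGraph α) : Prop :=
  ∀ V W : Finset α, Disjoint V W →
    ∃ v, v ∉ V ∧ v ∉ W ∧ (∀ u ∈ V, G.Adj v u) ∧ ∀ w ∈ W, ¬ G.Adj v w

/-- A map out of the naturals can be built by choosing each value in terms of
the preceding ones. -/
theorem exists_seq_of_forall_fin_exists {α : Type*} (P : ∀ n : ℕ, (Fin n → α) → α → Prop)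
    (h : ∀ n f, ∃ v, P n f v) : ∃ f : ℕ → α, ∀ n, P n (fun i => f i) (f n) := by
  choose g hg using h
  let f : ℕ → α := Nat.lt_wfRel.wf.fix fun n ih => g n fun i => ih i i.isLt
  refine ⟨f, fun n => ?_⟩
  have hf : f n = g n fun i => f i := Nat.lt_wfRel.wf.fix_eq _ n
  rw [hf]
  exact hg n _

/-- In a graph with the Rado property, every adjacency pattern on a finite
family of distinct vertices is realized by a new vertex. -/
theorem RadoProperty.exists_adj_iff {α : Type} {R : SimpleGraph α} (hR : RadoProperty R)
    {ι : Type*} [Finite ι] {f : ι → α} (hf : Function.Injective f) (p : ι → Prop) :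
    ∃ v, ∀ i, v ≠ f i ∧ (R.Adj v (f i) ↔ p i) := by
  classical
  have := Fintype.ofFinite ι
  obtain ⟨v, hV, hW, hadj, hnadj⟩ := hR
    ((Finset.univ.filter p).image f) ((Finset.univ.filter fun i => ¬ p i).image f)
    ((Finset.disjoint_image hf).2 (Finset.disjoint_filter_filter_not _ _ _))
  refine ⟨v, fun i => ?_⟩
  by_cases hi : p i
  · have hmem : f i ∈ (Finset.univ.filter p).image f :=
      Finset.mem_image_of_mem f (by simpa using hi)
    exact ⟨fun h => hV (h ▸ hmem), iff_of_true (hadj _ hmem) hi⟩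
  · have hmem : f i ∈ (Finset.univ.filter fun i => ¬ p i).image f :=
      Finset.mem_image_of_mem f (by simpa using hi)
    exact ⟨fun h => hW (h ▸ hmem), iff_of_false (hnadj _ hmem) hi⟩

/-- Every graph on the natural numbers embeds into every graph with the Rado property. -/
theorem RadoProperty.nonempty_embedding_nat {α : Type} {R : SimpleGraph α}
    (hR : RadoProperty R) (G : SimpleGraph ℕ) : Nonempty (G ↪g R) := by
  obtain ⟨f, hf⟩ := exists_seq_of_forall_fin_exists
    (fun n (f : Fin n → α) v => Function.Injective f →
      ∀ i, v ≠ f i ∧ (R.Adj v (f i) ↔ G.Adj n i)) (by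
    intro n f
    by_cases hf : Function.Injective f
    · obtain ⟨v, hv⟩ := hR.exists_adj_iff hf fun i => G.Adj n i
      exact ⟨v, fun _ => hv⟩
    · obtain ⟨v, -⟩ := hR ∅ ∅ (Finset.disjoint_empty_left _)
      exact ⟨v, fun h => absurd h hf⟩)
  have hne : ∀ n m, m < n → f n ≠ f m := by
    intro n
    induction n using Nat.strong_induction_on with
    | _ n ih =>
      intro m hm
      refine (hf n ?_ ⟨m, hm⟩).1
      intro i j hij
      rcases lt_trichotomy i j with h | h | h
      · exact absurd hij.symm (ih j j.isLt i h)
      · exact h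
      · exact absurd hij (ih i i.isLt j h)
  have hinj : Function.Injective f := by
    intro m n hmn
    rcases lt_trichotomy m n with h | h | h
    · exact absurd hmn.symm (hne n m h)
    · exact h
    · exact absurd hmn (hne m n h)
  have hadj : ∀ n m, m < n → (R.Adj (f n) (f m) ↔ G.Adj n m) := fun n m hm =>
    (hf n (hinj.comp Fin.val_injective) ⟨m, hm⟩).2
  refine ⟨⟨⟨f, hinj⟩, fun {m n} => ?_⟩⟩
  change R.Adj (f m) (f n) ↔ G.Adj m n
  rcases lt_trichotomy m n with h | rfl | h
  · rw [R.adj_comm, G.adj_comm]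
    exact hadj n m h
  · simp
  · exact hadj m n h

/-- Every countable simple graph is isomorphic to an induced subgraph of any
Rado graph: there is an injective vertex map preserving adjacency and
non-adjacency. -/
theorem rado_universal {α β : Type} [Countable α] [Countable β]
    (R : SimpleGraph α) (hR : RadoProperty R) (G : SimpleGraph β) :
    ∃ f : β → α, Function.Injective f ∧
      ∀ u v : β, R.Adj (f u) (f v) ↔ G.Adj u v := by
  obtain ⟨e, he⟩ := exists_injective_nat β
  obtain ⟨φ⟩ := hR.nonempty_embedding_nat (G.map (⟨e, he⟩ : β ↪ ℕ))
  let ψ : G ↪g R := φ.comp (SimpleGraph.Embedding.map ⟨e, he⟩ G)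
  exact ⟨ψ, ψ.injective, fun _ _ => ψ.map_adj_iff⟩
end

section
/- Any two Rado graphs are isomorphic: if R and S are countably infinite simple graphs each satisfying the Rado property, then there exists a graph isomorphism from R to S. -/
/-- A finite relation between the vertices of two graphs is a partial isomorphism if it is
the graph of an injective partial function preserving and reflecting adjacency. -/
def IsFinitePartialIso {α β : Type} (R : SimpleGraph α) (S : SimpleGraph β)
    (f : Finset (α × β)) : Prop :=
  ∀ p ∈ f, ∀ q ∈ f, (p.1 = q.1 ↔ p.2 = q.2) ∧ (R.Adj p.1 q.1 ↔ S.Adj p.2 q.2)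

namespace IsFinitePartialIso

variable {α β : Type} {R : SimpleGraph α} {S : SimpleGraph β} {f : Finset (α × β)}

theorem swap (hf : IsFinitePartialIso R S f) :
    IsFinitePartialIso S R (f.map (Equiv.prodComm α β).toEmbedding) := by
  intro p hp q hq
  obtain ⟨p, hpf, rfl⟩ := Finset.mem_map.1 hp
  obtain ⟨q, hqf, rfl⟩ := Finset.mem_map.1 hq
  exact ⟨(hf p hpf q hqf).1.symm, (hf p hpf q hqf).2.symm⟩

/-- If the target graph has the Rado property, a finite partial isomorphism extends to any
given vertex of the source. -/
theorem exists_extension_left (hS : RadoProperty S) (hf : IsFinitePartialIso R S f) (a : α) :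
    ∃ g, IsFinitePartialIso R S g ∧ f ⊆ g ∧ ∃ b, (a, b) ∈ g := by
  classical
  by_cases ha : ∃ b, (a, b) ∈ f
  · exact ⟨f, hf, subset_rfl, ha⟩
  have hdisj : Disjoint ({p ∈ f | R.Adj a p.1}.image Prod.snd)
      ({p ∈ f | ¬ R.Adj a p.1}.image Prod.snd) := by
    simp only [Finset.disjoint_left, Finset.mem_image, Finset.mem_filter]
    rintro _ ⟨p, ⟨hp, hpa⟩, rfl⟩ ⟨q, ⟨hq, hqa⟩, hqp⟩
    exact hqa ((hf q hq p hp).1.2 hqp ▸ hpa)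
  obtain ⟨b, hbV, hbW, hadj, hnadj⟩ := hS _ _ hdisj
  have key : ∀ p ∈ f, a ≠ p.1 ∧ b ≠ p.2 ∧ (R.Adj a p.1 ↔ S.Adj b p.2) := by
    intro p hp
    refine ⟨fun h ↦ ha ⟨p.2, h ▸ hp⟩, ?_⟩
    by_cases h : R.Adj a p.1
    · have hmem : p.2 ∈ {p ∈ f | R.Adj a p.1}.image Prod.snd :=
        Finset.mem_image_of_mem _ (Finset.mem_filter.2 ⟨hp, h⟩)
      exact ⟨fun e ↦ hbV (e ▸ hmem), iff_of_true h (hadj _ hmem)⟩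
    · have hmem : p.2 ∈ {p ∈ f | ¬ R.Adj a p.1}.image Prod.snd :=
        Finset.mem_image_of_mem _ (Finset.mem_filter.2 ⟨hp, h⟩)
      exact ⟨fun e ↦ hbW (e ▸ hmem), iff_of_false h (hnadj _ hmem)⟩
  refine ⟨insert (a, b) f, ?_, Finset.subset_insert _ _, b, Finset.mem_insert_self _ _⟩
  intro p hp q hq
  rcases Finset.mem_insert.1 hp with rfl | hp <;> rcases Finset.mem_insert.1 hq with rfl | hq
  · simp
  · obtain ⟨h₁, h₂, h₃⟩ := key q hq
    exact ⟨iff_of_false h₁ h₂, h₃⟩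
  · obtain ⟨h₁, h₂, h₃⟩ := key p hp
    exact ⟨iff_of_false h₁.symm h₂.symm, by rw [R.adj_comm, S.adj_comm, h₃]⟩
  · exact hf p hp q hq

/-- If the source graph has the Rado property, a finite partial isomorphism extends to any
given vertex of the target. -/
theorem exists_extension_right (hR : RadoProperty R) (hf : IsFinitePartialIso R S f) (b : β) :
    ∃ g, IsFinitePartialIso R S g ∧ f ⊆ g ∧ ∃ a, (a, b) ∈ g := by
  obtain ⟨g, hg, hfg, a, hab⟩ := hf.swap.exists_extension_left hR b
  refine ⟨_, hg.swap, fun p hp ↦ ?_, a, Finset.mem_map.2 ⟨(b, a), hab, rfl⟩⟩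
  exact Finset.mem_map.2 ⟨p.swap, hfg (Finset.mem_map.2 ⟨p, hp, rfl⟩), rfl⟩

end IsFinitePartialIso

/-- Uniqueness of the Rado graph: any two countably infinite simple graphs
satisfying the Rado property are isomorphic. -/
theorem rado_unique {α β : Type} [Countable α] [Infinite α]
    [Countable β] [Infinite β] (R : SimpleGraph α) (S : SimpleGraph β)
    (hR : RadoProperty R) (hS : RadoProperty S) :
    Nonempty (R ≃g S) := by
  cases nonempty_encodable α
  cases nonempty_encodable β
  let definedAt : α ⊕ β → Order.Cofinal {f // IsFinitePartialIso R S f}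
    | .inl a => ⟨{f | ∃ b, (a, b) ∈ f.1}, fun f ↦
        let ⟨g, hg, hfg, h⟩ := f.2.exists_extension_left hS a
        ⟨⟨g, hg⟩, h, hfg⟩⟩
    | .inr b => ⟨{f | ∃ a, (a, b) ∈ f.1}, fun f ↦
        let ⟨g, hg, hfg, h⟩ := f.2.exists_extension_right hR b
        ⟨⟨g, hg⟩, h, hfg⟩⟩
  let I := Order.idealOfCofinals ⟨∅, by simp [IsFinitePartialIso]⟩ definedAt
  have hleft (a : α) : ∃ b, ∃ f ∈ I, (a, b) ∈ f.1 := by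
    obtain ⟨f, ⟨b, hb⟩, hf⟩ := Order.cofinal_meets_idealOfCofinals _ definedAt (.inl a)
    exact ⟨b, f, hf, hb⟩
  have hright (b : β) : ∃ a, ∃ f ∈ I, (a, b) ∈ f.1 := by
    obtain ⟨f, ⟨a, ha⟩, hf⟩ := Order.cofinal_meets_idealOfCofinals _ definedAt (.inr b)
    exact ⟨a, f, hf, ha⟩
  have compat {a a' : α} {b b' : β} (h : ∃ f ∈ I, (a, b) ∈ f.1)
      (h' : ∃ f ∈ I, (a', b') ∈ f.1) : (a = a' ↔ b = b') ∧ (R.Adj a a' ↔ S.Adj b b') := by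
    obtain ⟨f, hf, hab⟩ := h
    obtain ⟨g, hg, hab'⟩ := h'
    obtain ⟨m, -, hfm, hgm⟩ := I.directed _ hf _ hg
    exact m.2 _ (hfm hab) _ (hgm hab')
  choose F hF using hleft
  choose G hG using hright
  exact ⟨⟨⟨F, G, fun a ↦ (compat (hG (F a)) (hF a)).1.2 rfl,
    fun b ↦ (compat (hF (G b)) (hG b)).1.1 rfl⟩, fun {a a'} ↦ (compat (hF a) (hF a')).2.symm⟩⟩
end
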